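/- arXiv:2507.08965 — 10 statements merged into one kernel-verified Lean document; each statement's English description precedes it below -/
import Mathlib

section
/- With the forward masked rate matrix R_t and the explicit function p t x = exp(−σ̄ t)^{k(x)} · (1 − exp(−σ̄ t))^{d − k(x)} · S(x), the following hold: p 0 = p₀, and for every t ∈ ℝ and every state x ∈ (Fin M)^d, the map t ↦ p t x has derivative ((R_t).mulVec (p t)) x at t. In other words, the explicit product-form function p solves the forward masked-diffusion equation d p_t/dt = R_t p_t with initial condition p₀. -/
open Finset
open scoped Classical

noncomputable section MaskedDiffusion

variable {M d : ℕ}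

/-- Number of unmasked coordinates of a state `x ∈ (Fin M)^d`, where `m` is the mask token. -/
def numUnmasked (m : Fin M) (x : Fin d → Fin M) : ℕ :=
  (Finset.univ.filter fun i => x i ≠ m).card

/-- The forward masked rate matrix at time `t`:
`R_t(y, x) = σ t` if `y` is obtained from `x` by replacing exactly one unmasked coordinate
of `x` by the mask `m`, `R_t(x, x) = -σ t · k(x)`, and `R_t(y, x) = 0` otherwise. -/
def forwardRate (m : Fin M) (σ : ℝ → ℝ) (t : ℝ) :
    Matrix (Fin d → Fin M) (Fin d → Fin M) ℝ :=
  fun y x =>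
    if y = x then -(σ t) * (numUnmasked m x : ℝ)
    else if ∃ i, x i ≠ m ∧ y = Function.update x i m then σ t
    else 0

/-- Integrated noise schedule `σ̄ t = ∫_0^t σ`. -/
def sigmaBar (σ : ℝ → ℝ) (t : ℝ) : ℝ := ∫ s in (0 : ℝ)..t, σ s

/-- `S(x) = ∑ p₀ x₀` over all fully-unmasked `x₀` agreeing with `x` on the unmasked
coordinates of `x`. -/
def Sfun (m : Fin M) (p₀ : (Fin d → Fin M) → ℝ) (x : Fin d → Fin M) : ℝ :=
  ∑ x₀ ∈ Finset.univ.filter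
      (fun x₀ : Fin d → Fin M =>
        numUnmasked m x₀ = d ∧ ∀ i, x i ≠ m → x₀ i = x i),
    p₀ x₀

/-- The explicit product-form candidate solution
`p t x = exp(-σ̄ t)^{k(x)} · (1 - exp(-σ̄ t))^{d - k(x)} · S(x)`. -/
def forwardMarginal (m : Fin M) (σ : ℝ → ℝ) (p₀ : (Fin d → Fin M) → ℝ)
    (t : ℝ) (x : Fin d → Fin M) : ℝ :=
  Real.exp (-(sigmaBar σ t)) ^ numUnmasked m x *
    (1 - Real.exp (-(sigmaBar σ t))) ^ (d - numUnmasked m x) *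
    Sfun m p₀ x

end MaskedDiffusion

theorem nu_le {M d : ℕ} (m : Fin M) (x : Fin d → Fin M) : numUnmasked m x ≤ d := by
  unfold numUnmasked
  simpa using Finset.card_filter_le (Finset.univ : Finset (Fin d)) (fun i => x i ≠ m)

theorem nu_eq {M d : ℕ} (m : Fin M) (x : Fin d → Fin M) :
    numUnmasked m x = d ↔ ∀ i, x i ≠ m := by
  unfold numUnmasked
  have h := Finset.card_filter_eq_iff (s := (Finset.univ : Finset (Fin d))) (p := fun i => x i ≠ m)
  simpa using h

theorem nu_update {M d : ℕ} (m : Fin M) (x : Fin d → Fin M) (i : Fin d) (v : Fin M)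
    (hx : x i = m) (hv : v ≠ m) :
    numUnmasked m (Function.update x i v) = numUnmasked m x + 1 := by
  unfold numUnmasked
  rw [← Finset.card_insert_of_notMem (a := i) (by simp [hx])]
  congr 1
  ext j
  by_cases h : j = i
  · subst h; simp [hv]
  · simp [h]

theorem card_masked {M d : ℕ} (m : Fin M) (x : Fin d → Fin M) :
    (Finset.univ.filter fun i => x i = m).card = d - numUnmasked m x := by
  have h := Finset.card_filter_add_card_filter_not (s := (Finset.univ : Finset (Fin d)))
    (fun i => x i = m)
  have h2 : (Finset.univ.filter fun i => ¬ x i = m).card = numUnmasked m x := rfl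
  rw [h2] at h
  simp only [Finset.card_univ, Fintype.card_fin] at h
  omega

theorem S_sum {M d : ℕ} (m : Fin M) (p₀ : (Fin d → Fin M) → ℝ) (x : Fin d → Fin M) (i : Fin d)
    (hx : x i = m) :
    ∑ v ∈ Finset.univ.filter (fun v => v ≠ m), Sfun m p₀ (Function.update x i v)
      = Sfun m p₀ x := by
  unfold Sfun
  rw [← Finset.sum_fiberwise_of_maps_to (t := Finset.univ.filter (fun v => v ≠ m))
    (g := fun x₀ : Fin d → Fin M => x₀ i)]
  · apply Finset.sum_congr rfl
    intro v hv
    simp only [Finset.mem_filter, Finset.mem_univ, true_and] at hv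
    apply Finset.sum_congr _ (fun _ _ => rfl)
    ext z
    simp only [Finset.mem_filter, Finset.mem_univ, true_and]
    constructor
    · rintro ⟨h1, h2⟩
      refine ⟨⟨h1, fun j hj => ?_⟩, ?_⟩
      · have hne : j ≠ i := by rintro rfl; exact hj hx
        simpa [hne] using h2 j (by simpa [hne] using hj)
      · simpa using h2 i (by simpa using hv)
    · rintro ⟨⟨h1, h2⟩, h3⟩
      refine ⟨h1, fun j hj => ?_⟩
      by_cases h : j = i
      · subst h; simpa using h3
      · simp only [Function.update_of_ne h] at hj ⊢
        exact h2 j hj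
  · intro z hz
    simp only [Finset.mem_filter, Finset.mem_univ, true_and] at hz ⊢
    exact (nu_eq m z).1 hz.1 i

theorem pre_sum {M d : ℕ} (m : Fin M) (x : Fin d → Fin M) (f : (Fin d → Fin M) → ℝ) :
    ∑ z ∈ Finset.univ.filter
        (fun z : Fin d → Fin M => ∃ i, z i ≠ m ∧ x = Function.update z i m), f z
      = ∑ i ∈ Finset.univ.filter (fun i => x i = m),
          ∑ v ∈ Finset.univ.filter (fun v => v ≠ m), f (Function.update x i v) := by
  rw [← Finset.sum_product', ← Finset.sum_image
    (g := fun q : Fin d × Fin M => Function.update x q.1 q.2)]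
  · apply Finset.sum_congr _ (fun _ _ => rfl)
    ext z
    simp only [Finset.mem_filter, Finset.mem_univ, true_and, Finset.mem_image,
      Finset.mem_product, Prod.exists]
    constructor
    · rintro ⟨i, h1, rfl⟩
      exact ⟨i, z i, ⟨by simp, h1⟩, by simp⟩
    · rintro ⟨i, v, ⟨h1, h2⟩, rfl⟩
      refine ⟨i, by simpa using h2, ?_⟩
      simp [← h1]
  · rintro ⟨i, v⟩ h ⟨j, w⟩ h' he
    simp only [Finset.coe_product, Finset.coe_filter, Finset.mem_univ, true_and, Set.mem_prod,
      Set.mem_ofPred_eq] at h h' he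
    have hij : i = j := by
      by_contra hne
      have := congrFun he i
      simp only [Function.update_self, Function.update_of_ne hne] at this
      exact h.2 (this.trans h.1)
    subst hij
    have := congrFun he i
    simp only [Function.update_self] at this
    rw [this]

theorem mulVec_eq {M d : ℕ} (m : Fin M) (σ : ℝ → ℝ) (t : ℝ) (x : Fin d → Fin M)
    (f : (Fin d → Fin M) → ℝ) :
    (forwardRate m σ t).mulVec f x = -(σ t) * (numUnmasked m x : ℝ) * f x +
      σ t * ∑ i ∈ Finset.univ.filter (fun i => x i = m),
          ∑ v ∈ Finset.univ.filter (fun v => v ≠ m), f (Function.update x i v) := by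
  rw [← pre_sum, Finset.mul_sum, Finset.sum_filter]
  have h0 : -(σ t) * (numUnmasked m x : ℝ) * f x
      = ∑ z, if x = z then -(σ t) * (numUnmasked m z : ℝ) * f z else 0 := by
    simp
  rw [h0, ← Finset.sum_add_distrib]
  simp only [Matrix.mulVec, dotProduct]
  apply Finset.sum_congr rfl
  intro z _
  unfold forwardRate
  by_cases h : x = z
  · have hn : ¬ ∃ i, z i ≠ m ∧ x = Function.update z i m := by
      rintro ⟨i, h1, h2⟩
      apply h1
      rw [← h, h2]; simp
    rw [if_pos h, if_pos h, if_neg hn, add_zero]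
  · rw [if_neg h, if_neg h, zero_add]
    split_ifs <;> simp


/-- With the forward masked rate matrix `R_t` and the explicit function
`p t x = exp(-σ̄ t)^{k(x)} · (1 - exp(-σ̄ t))^{d - k(x)} · S(x)`, we have `p 0 = p₀`, and
for every `t ∈ ℝ` and every state `x ∈ (Fin M)^d`, the map `t ↦ p t x` has derivative
`((R_t).mulVec (p t)) x` at `t`; that is, the explicit product-form function solves the
forward masked-diffusion equation `d p_t/dt = R_t p_t` with initial condition `p₀`. -/
theorem forwardMarginal_solves_forward_equation
    (M d : ℕ) (hM : 2 ≤ M) (hd : 1 ≤ d)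
    (m : Fin M) (hm : (m : ℕ) = M - 1)
    (σ : ℝ → ℝ) (hσ : Continuous σ)
    (p₀ : (Fin d → Fin M) → ℝ)
    (hp₀_nonneg : ∀ x, 0 ≤ p₀ x) (hp₀_sum : ∑ x, p₀ x = 1)
    (hp₀_supp : ∀ x, numUnmasked m x ≠ d → p₀ x = 0) :
    forwardMarginal m σ p₀ 0 = p₀ ∧
    ∀ (t : ℝ) (x : Fin d → Fin M),
      HasDerivAt (fun t => forwardMarginal m σ p₀ t x)
        ((forwardRate m σ t).mulVec (forwardMarginal m σ p₀ t) x) t := by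
  constructor
  · funext x
    unfold forwardMarginal
    have h0 : sigmaBar σ 0 = 0 := by simp [sigmaBar]
    rw [h0]
    by_cases h : numUnmasked m x = d
    · have hS : Sfun m p₀ x = p₀ x := by
        unfold Sfun
        rw [← Finset.sum_singleton p₀ x]
        apply Finset.sum_congr _ (fun _ _ => rfl)
        ext z
        simp only [Finset.mem_filter, Finset.mem_univ, true_and, Finset.mem_singleton]
        constructor
        · rintro ⟨_, h2⟩
          funext i
          exact h2 i ((nu_eq m x).1 h i)
        · rintro rfl
          exact ⟨h, fun _ _ => rfl⟩
      rw [hS, h]; simp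
    · have hlt : d - numUnmasked m x ≠ 0 := by
        have := nu_le m x
        omega
      rw [hp₀_supp x h]
      simp [hlt]
  · intro t x
    have hs : HasDerivAt (sigmaBar σ) (σ t) t := by
      unfold sigmaBar
      exact intervalIntegral.integral_hasDerivAt_right (hσ.intervalIntegrable _ _)
        (hσ.stronglyMeasurableAtFilter _ _) hσ.continuousAt
    have he : HasDerivAt (fun t => Real.exp (-(sigmaBar σ t)))
        (Real.exp (-(sigmaBar σ t)) * (-(σ t))) t := hs.neg.exp
    have hD := (((he.pow (numUnmasked m x)).mul
      ((he.const_sub 1).pow (d - numUnmasked m x))).mul_const (Sfun m p₀ x))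
    refine hD.congr_deriv ?_
    rw [mulVec_eq]
    have hsum : ∑ i ∈ Finset.univ.filter (fun i => x i = m),
          ∑ v ∈ Finset.univ.filter (fun v => v ≠ m),
            forwardMarginal m σ p₀ t (Function.update x i v)
        = ((d - numUnmasked m x : ℕ) : ℝ) * (Real.exp (-(sigmaBar σ t)) ^ (numUnmasked m x + 1) *
          (1 - Real.exp (-(sigmaBar σ t))) ^ (d - numUnmasked m x - 1) * Sfun m p₀ x) := by
      rw [← card_masked, ← nsmul_eq_mul, ← Finset.sum_const]
      apply Finset.sum_congr rfl
      intro i hi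
      simp only [Finset.mem_filter, Finset.mem_univ, true_and] at hi
      rw [← S_sum m p₀ x i hi, Finset.mul_sum]
      apply Finset.sum_congr rfl
      intro v hv
      simp only [Finset.mem_filter, Finset.mem_univ, true_and] at hv
      unfold forwardMarginal
      rw [nu_update m x i v hi hv, card_masked, Nat.sub_sub]
    rw [hsum]
    unfold forwardMarginal
    simp only [Pi.pow_apply]
    generalize Real.exp (-(sigmaBar σ t)) = e
    generalize d - numUnmasked m x = n
    rcases numUnmasked m x with _ | k
    · simp; ring
    · simp only [Nat.add_sub_cancel]; ring
end

section
/- Let t > 0, let x ∈ (Fin M)^d have x i = m for some coordinate i, let a ≠ m and set x̂ = Function.update x i a. If S(x) > 0, then p t x̂ / p t x = (exp(−σ̄ t)/(1 − exp(−σ̄ t))) · (S(x̂)/S(x)). Here S(x̂)/S(x) is exactly the conditional probability under p₀ that the i-th token equals a given that the tokens at the unmasked coordinates U(x) agree with x, i.e. the score of masked diffusion factorizes as a time-dependent scalar times a time-independent conditional probability p₀(x̂^i | x^{UM}). -/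
open Finset
open scoped Classical

/-- Let `t > 0`, let `x ∈ (Fin M)^d` have `x i = m` for some coordinate
`i`, let `a ≠ m` and set `x̂ = Function.update x i a`.  If `S(x) > 0`, then
`p t x̂ / p t x = (exp(-σ̄ t)/(1 - exp(-σ̄ t))) · (S(x̂)/S(x))`, i.e. the score of masked
diffusion factorizes as a time-dependent scalar times the time-independent conditional
probability `S(x̂)/S(x) = p₀(x̂^i | x^{UM})`. -/
theorem score_factorization_masked_diffusion
    (M d : ℕ) (hM : 2 ≤ M) (hd : 1 ≤ d)
    (m : Fin M) (hm : (m : ℕ) = M - 1)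
    (σ : ℝ → ℝ) (hσ : Continuous σ) (hσpos : ∀ t, 0 < t → 0 < σ t)
    (p₀ : (Fin d → Fin M) → ℝ)
    (hp₀_nonneg : ∀ x, 0 ≤ p₀ x) (hp₀_sum : ∑ x, p₀ x = 1)
    (hp₀_supp : ∀ x, numUnmasked m x ≠ d → p₀ x = 0)
    (t : ℝ) (ht : 0 < t)
    (x : Fin d → Fin M) (i : Fin d) (hxi : x i = m)
    (a : Fin M) (ha : a ≠ m)
    (hS : 0 < Sfun m p₀ x) :
    forwardMarginal m σ p₀ t (Function.update x i a) / forwardMarginal m σ p₀ t x =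
      Real.exp (-(sigmaBar σ t)) / (1 - Real.exp (-(sigmaBar σ t))) *
        (Sfun m p₀ (Function.update x i a) / Sfun m p₀ x) := by
  have hpos : 0 < sigmaBar σ t := by
    unfold sigmaBar
    exact intervalIntegral.intervalIntegral_pos_of_pos_on (hσ.intervalIntegrable 0 t)
      (fun s hs => hσpos s hs.1) ht
  have h1 : 0 < 1 - Real.exp (-(sigmaBar σ t)) := by
    have : Real.exp (-(sigmaBar σ t)) < 1 := Real.exp_lt_one_iff.mpr (by linarith)
    linarith
  have hset : (Finset.univ.filter fun j => Function.update x i a j ≠ m)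
      = insert i (Finset.univ.filter fun j => x j ≠ m) := by
    ext j
    by_cases hj : j = i
    · subst hj
      simp [ha]
    · simp [hj]
  have hk : numUnmasked m (Function.update x i a) = numUnmasked m x + 1 := by
    unfold numUnmasked
    rw [hset, Finset.card_insert_of_notMem (by simp [hxi])]
  have hle : numUnmasked m (Function.update x i a) ≤ d := by
    unfold numUnmasked
    exact (Finset.card_le_univ _).trans (by simp)
  obtain ⟨n, hn⟩ : ∃ n, d = numUnmasked m x + 1 + n := Nat.exists_eq_add_of_le (hk ▸ hle)
  have e1 : d - numUnmasked m x = n + 1 := by omega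
  have e2 : d - (numUnmasked m x + 1) = n := by omega
  have he := Real.exp_pos (-(sigmaBar σ t))
  unfold forwardMarginal
  rw [hk, e1, e2]
  generalize Real.exp (-(sigmaBar σ t)) = e at *
  generalize hq : 1 - e = q at *
  have hS' := hS.ne'
  have h1' := h1.ne'
  have he' := he.ne'
  rw [pow_succ, pow_succ]
  field_simp
end

section
/- Let w : ℝ → ℝ be continuous on (0,T] and let ρ be a reverse-dynamics solution for the family (R^{(w_s)}_s) on (t₀, T] for some t₀ ∈ (0,T), with terminal condition ρ T = the indicator vector of the mask state m. Then for every t ∈ (t₀, T]: ρ t m = exp(−∫_t^T c s · Z_{w s} ds), and for every i ≠ m, ρ t i = ∫_t^T c s · Z_{w s} · p^{(w s)} i · exp(−∫_s^T c τ · Z_{w τ} dτ) ds. In particular the unmasked part of ρ t is a weighted average of the tilted distributions p^{(w_s)}, s ∈ [t,T], with nonnegative weights c s · Z_{w s} · exp(−∫_s^T c τ Z_{w τ} dτ) summing (in s) to 1 − ρ t m. -/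
open Finset

noncomputable section GuidedMaskedDiffusion1D

variable {M : ℕ}

/-- Partition function `Z_w = ∑_{i ≠ m} (p i)^w (q i)^{1-w}`. -/
def Zw (m : Fin M) (p q : Fin M → ℝ) (w : ℝ) : ℝ :=
  ∑ i ∈ Finset.univ.filter (fun i => i ≠ m), (p i) ^ w * (q i) ^ (1 - w)

/-- Tilted distribution `p^{(w)} i = (p i)^w (q i)^{1-w} / Z_w` for `i ≠ m`, and
`p^{(w)} m = 0`. -/
def tilted (m : Fin M) (p q : Fin M → ℝ) (w : ℝ) : Fin M → ℝ :=
  fun i => if i = m then 0 else (p i) ^ w * (q i) ^ (1 - w) / Zw m p q w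

/-- `c t = σ t · exp(-σ̄ t) / (1 - exp(-σ̄ t))`. -/
def cFun (σ : ℝ → ℝ) (t : ℝ) : ℝ :=
  σ t * Real.exp (-(sigmaBar σ t)) / (1 - Real.exp (-(sigmaBar σ t)))

/-- The matrix `A_w`: its column indexed by `m` has entries `(A_w) i m = p^{(w)} i` for
`i ≠ m` and `(A_w) m m = -1`; all other columns vanish. -/
def Amat (m : Fin M) (p q : Fin M → ℝ) (w : ℝ) : Matrix (Fin M) (Fin M) ℝ :=
  fun i j => if j = m then (if i = m then -1 else tilted m p q w i) else 0

/-- The (unnormalized) guided rate matrix `R^{(w)}_t = (c t · Z_w) • A_w`. -/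
def guidedRate (m : Fin M) (p q : Fin M → ℝ) (σ : ℝ → ℝ) (w t : ℝ) :
    Matrix (Fin M) (Fin M) ℝ :=
  (cFun σ t * Zw m p q w) • Amat m p q w

/-- The column-normalized guided rate matrix `R_nor^{(w)}_t = (c t) • A_w`. -/
def guidedRateNor (m : Fin M) (p q : Fin M → ℝ) (σ : ℝ → ℝ) (w t : ℝ) :
    Matrix (Fin M) (Fin M) ℝ :=
  cFun σ t • Amat m p q w

/-- A reverse-dynamics solution for a family of rate matrices `Rfam` on an interval `I`:
a continuous `ρ` such that, at every `s` in the interior of `I`, `ρ` has derivative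
`-(Rfam s).mulVec (ρ s)` at `s`. -/
def IsReverseSol (Rfam : ℝ → Matrix (Fin M) (Fin M) ℝ) (I : Set ℝ)
    (ρ : ℝ → Fin M → ℝ) : Prop :=
  ContinuousOn ρ I ∧ ∀ s ∈ interior I, HasDerivAt ρ (-((Rfam s).mulVec (ρ s))) s

end GuidedMaskedDiffusion1D

theorem sigmaBar_pos' (σ : ℝ → ℝ) (hσ : Continuous σ) (hσpos : ∀ t, 0 < t → 0 < σ t)
    (t : ℝ) (ht : 0 < t) : 0 < sigmaBar σ t := by
  unfold sigmaBar
  exact intervalIntegral.intervalIntegral_pos_of_pos_on (hσ.intervalIntegrable _ _)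
    (fun x hx => hσpos x hx.1) ht

theorem sigmaBar_cont' (σ : ℝ → ℝ) (hσ : Continuous σ) : Continuous (sigmaBar σ) := by
  unfold sigmaBar
  exact intervalIntegral.continuous_primitive (fun a b => hσ.intervalIntegrable a b) 0

theorem one_sub_pos' (σ : ℝ → ℝ) (hσ : Continuous σ) (hσpos : ∀ t, 0 < t → 0 < σ t)
    (t : ℝ) (ht : 0 < t) : 0 < 1 - Real.exp (-(sigmaBar σ t)) := by
  have := sigmaBar_pos' σ hσ hσpos t ht
  have h : Real.exp (-(sigmaBar σ t)) < 1 := by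
    rw [← Real.exp_zero]; exact Real.exp_lt_exp.2 (by linarith)
  linarith

theorem exp_ode' (a f : ℝ → ℝ) (t T : ℝ) (htT : t ≤ T) (ha : ContinuousOn a (Set.Icc t T))
    (hf : ContinuousOn f (Set.Icc t T))
    (hd : ∀ s ∈ Set.Ioo t T, HasDerivAt f (a s * f s) s) (h1 : f T = 1) :
    f t = Real.exp (-(∫ s in t..T, a s)) := by
  have hint : IntervalIntegrable a MeasureTheory.volume t T :=
    (ha.mono (by rw [Set.uIcc_of_le htT])).intervalIntegrable
  have hsub : ∀ s ∈ Set.Icc t T, IntervalIntegrable a MeasureTheory.volume s T := by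
    intro s hs
    exact (ha.mono (by rw [Set.uIcc_of_le hs.2]; exact Set.Icc_subset_Icc_left hs.1)).intervalIntegrable
  have hFc : ContinuousOn (fun s => ∫ u in s..T, a u) (Set.Icc t T) := by
    have := intervalIntegral.continuousOn_primitive_interval_left
      (a := t) (b := T) (f := a) (μ := MeasureTheory.volume)
      (by rw [Set.uIcc_of_le htT]; exact ha.integrableOn_Icc)
    rwa [Set.uIcc_of_le htT] at this
  have hFd : ∀ s ∈ Set.Ioo t T, HasDerivAt (fun s => ∫ u in s..T, a u) (-(a s)) s := by
    intro s hs
    have hn : Set.Icc t T ∈ nhds s := Icc_mem_nhds hs.1 hs.2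
    refine intervalIntegral.integral_hasDerivAt_left (hsub s ⟨hs.1.le, hs.2.le⟩) ?_
      (ha.continuousAt hn)
    exact ContinuousOn.stronglyMeasurableAtFilter isOpen_Ioo
      (ha.mono Set.Ioo_subset_Icc_self) s hs
  have key := intervalIntegral.integral_eq_sub_of_hasDerivAt_of_le
    (f := fun s => f s * Real.exp (∫ u in s..T, a u)) (f' := fun _ => (0 : ℝ)) htT
    (hf.mul (Real.continuous_exp.comp_continuousOn hFc))
    (fun s hs => by
      have h := (hd s hs).mul (hFd s hs).exp
      exact h.congr_deriv (by ring)) (by simp)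
  simp only [intervalIntegral.integral_zero, intervalIntegral.integral_same, Real.exp_zero, h1] at key
  rw [Real.exp_neg]
  have := Real.exp_pos (∫ s in t..T, a s)
  field_simp
  linarith

/-- Let `w : ℝ → ℝ` be continuous on `(0, T]` and let `ρ` be a
reverse-dynamics solution for the family `(R^{(w_s)}_s)` on `(t₀, T]` for some
`t₀ ∈ (0, T)`, with terminal condition `ρ T` = the indicator of the mask state `m`.  Then
for every `t ∈ (t₀, T]`: `ρ t m = exp(-∫_t^T c s · Z_{w s} ds)`, and for every `i ≠ m`,
`ρ t i = ∫_t^T c s · Z_{w s} · p^{(w s)} i · exp(-∫_s^T c τ · Z_{w τ} dτ) ds`.  In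
particular the unmasked part of `ρ t` is a weighted average of the tilted distributions
`p^{(w s)}`, `s ∈ [t, T]`, with nonnegative weights summing (in `s`) to `1 - ρ t m`. -/
theorem guided_reverse_dynamics_general_schedule
    (M : ℕ) (hM : 2 ≤ M) (m : Fin M) (hm : (m : ℕ) = M - 1)
    (p q : Fin M → ℝ)
    (hp_nonneg : ∀ i, 0 ≤ p i) (hp_sum : ∑ i, p i = 1) (hpm : p m = 0)
    (hp_pos : ∀ i, i ≠ m → 0 < p i)
    (hq_nonneg : ∀ i, 0 ≤ q i) (hq_sum : ∑ i, q i = 1) (hqm : q m = 0)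
    (hq_pos : ∀ i, i ≠ m → 0 < q i)
    (T : ℝ) (hT : 0 < T)
    (σ : ℝ → ℝ) (hσ : Continuous σ) (hσpos : ∀ t, 0 < t → 0 < σ t)
    (w : ℝ → ℝ) (hw : ContinuousOn w (Set.Ioc 0 T))
    (t₀ : ℝ) (ht₀ : t₀ ∈ Set.Ioo 0 T)
    (ρ : ℝ → Fin M → ℝ)
    (hρ : IsReverseSol (fun s => guidedRate m p q σ (w s) s) (Set.Ioc t₀ T) ρ)
    (hρT : ρ T = fun i => if i = m then 1 else 0) :
    ∀ t ∈ Set.Ioc t₀ T,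
      ρ t m = Real.exp (-(∫ s in t..T, cFun σ s * Zw m p q (w s))) ∧
      (∀ i, i ≠ m →
        ρ t i = ∫ s in t..T,
          cFun σ s * Zw m p q (w s) * tilted m p q (w s) i *
            Real.exp (-(∫ τ in s..T, cFun σ τ * Zw m p q (w τ)))) ∧
      (∀ s ∈ Set.Icc t T,
        0 ≤ cFun σ s * Zw m p q (w s) *
              Real.exp (-(∫ τ in s..T, cFun σ τ * Zw m p q (w τ)))) ∧
      (∫ s in t..T,
          cFun σ s * Zw m p q (w s) *
            Real.exp (-(∫ τ in s..T, cFun σ τ * Zw m p q (w τ)))) = 1 - ρ t m := by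
  have hZpos : ∀ v, 0 < Zw m p q v := by
    intro v
    unfold Zw
    apply Finset.sum_pos
    · intro i hi
      have hi' : i ≠ m := by simpa using hi
      exact mul_pos (Real.rpow_pos_of_pos (hp_pos i hi') _) (Real.rpow_pos_of_pos (hq_pos i hi') _)
    · refine ⟨⟨0, by omega⟩, ?_⟩
      simp only [Finset.mem_filter, Finset.mem_univ, true_and, ne_eq, Fin.ext_iff]
      omega
  have hterm : ∀ i, i ≠ m → Continuous (fun v : ℝ => (p i) ^ v * (q i) ^ (1 - v)) := by
    intro i hi
    exact (Real.continuous_const_rpow (hp_pos i hi).ne').mul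
      ((Real.continuous_const_rpow (hq_pos i hi).ne').comp (continuous_const.sub continuous_id))
  have hZc : Continuous (Zw m p q) := by
    unfold Zw
    apply continuous_finsetSum
    intro i hi
    exact hterm i (by simpa using hi)
  have hTc : ∀ i, i ≠ m → Continuous (fun v => tilted m p q v i) := by
    intro i hi
    simp only [tilted, if_neg hi]
    exact (hterm i hi).div hZc (fun v => (hZpos v).ne')
  have hcnn : ∀ s, 0 < s → 0 ≤ cFun σ s := by
    intro s hs
    unfold cFun
    exact div_nonneg (mul_nonneg (hσpos s hs).le (Real.exp_pos _).le)
      (one_sub_pos' σ hσ hσpos s hs).le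
  have hcc : ContinuousOn (cFun σ) (Set.Ioc 0 T) := by
    have hb := sigmaBar_cont' σ hσ
    unfold cFun
    refine ContinuousOn.div ?_ ?_ (fun s hs => (one_sub_pos' σ hσ hσpos s hs.1).ne')
    · exact (hσ.mul (Real.continuous_exp.comp hb.neg)).continuousOn
    · exact (continuous_const.sub (Real.continuous_exp.comp hb.neg)).continuousOn
  have hac : ContinuousOn (fun s => cFun σ s * Zw m p q (w s)) (Set.Ioc 0 T) :=
    hcc.mul (hZc.comp_continuousOn hw)
  obtain ⟨hρc, hρd⟩ := hρ
  have hρci : ∀ i, ContinuousOn (fun s => ρ s i) (Set.Ioc t₀ T) :=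
    fun i => (continuous_apply i).comp_continuousOn hρc
  rw [interior_Ioc] at hρd
  have hmul : ∀ s i, (-((guidedRate m p q σ (w s) s).mulVec (ρ s))) i
      = -(cFun σ s * Zw m p q (w s) * (if i = m then -1 else tilted m p q (w s) i) * ρ s m) := by
    intro s i
    simp [guidedRate, Amat, Matrix.mulVec, dotProduct]
  have hdm : ∀ s ∈ Set.Ioo t₀ T,
      HasDerivAt (fun s => ρ s m) (cFun σ s * Zw m p q (w s) * ρ s m) s := by
    intro s hs
    have h := hasDerivAt_pi.1 (hρd s hs) m
    rw [hmul] at h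
    exact h.congr_deriv (by simp)
  have hdi : ∀ i, i ≠ m → ∀ s ∈ Set.Ioo t₀ T,
      HasDerivAt (fun s => -ρ s i)
        (cFun σ s * Zw m p q (w s) * tilted m p q (w s) i * ρ s m) s := by
    intro i hi s hs
    have h := hasDerivAt_pi.1 (hρd s hs) i
    rw [hmul, if_neg hi] at h
    exact h.neg.congr_deriv (by simp)
  have hρm : ∀ t ∈ Set.Ioc t₀ T,
      ρ t m = Real.exp (-(∫ s in t..T, cFun σ s * Zw m p q (w s))) := by
    intro t ht
    refine exp_ode' (fun s => cFun σ s * Zw m p q (w s)) (fun s => ρ s m) t T ht.2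
      (hac.mono ?_) ((hρci m).mono ?_) ?_ (by simp [hρT])
    · exact fun s hs => ⟨by linarith [ht₀.1, ht.1, hs.1], hs.2⟩
    · exact fun s hs => ⟨by linarith [ht.1, hs.1], hs.2⟩
    · exact fun s hs => hdm s ⟨by linarith [ht.1, hs.1], hs.2⟩
  intro t ht
  have hs0 : Set.Icc t T ⊆ Set.Ioc 0 T := fun s hs => ⟨by linarith [ht₀.1, ht.1, hs.1], hs.2⟩
  have hst : Set.Icc t T ⊆ Set.Ioc t₀ T := fun s hs => ⟨by linarith [ht.1, hs.1], hs.2⟩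
  have hso : Set.Ioo t T ⊆ Set.Ioo t₀ T := fun s hs => ⟨by linarith [ht.1, hs.1], hs.2⟩
  refine ⟨hρm t ht, ?_, ?_, ?_⟩
  · intro i hi
    have key := intervalIntegral.integral_eq_sub_of_hasDerivAt_of_le ht.2
      ((hρci i).mono hst).neg (fun s hs => hdi i hi s (hso hs))
      (ContinuousOn.intervalIntegrable (by
        rw [Set.uIcc_of_le ht.2]
        exact ((hac.mono hs0).mul ((hTc i hi).comp_continuousOn (hw.mono hs0))).mul
          ((hρci m).mono hst)))
    have h2 : ρ t i = ∫ s in t..T,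
        cFun σ s * Zw m p q (w s) * tilted m p q (w s) i * ρ s m := by
      rw [key]
      simp [hρT, hi]
    rw [h2]
    apply intervalIntegral.integral_congr
    intro s hs
    rw [Set.uIcc_of_le ht.2] at hs
    simp only
    rw [hρm s (hst hs)]
  · intro s hs
    exact mul_nonneg (mul_nonneg (hcnn s (hs0 hs).1) (hZpos _).le) (Real.exp_pos _).le
  · have key := intervalIntegral.integral_eq_sub_of_hasDerivAt_of_le ht.2
      ((hρci m).mono hst) (fun s hs => hdm s (hso hs))
      (ContinuousOn.intervalIntegrable (by
        rw [Set.uIcc_of_le ht.2]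
        exact (hac.mono hs0).mul ((hρci m).mono hst)))
    have h2 : ∫ s in t..T, cFun σ s * Zw m p q (w s) * ρ s m = 1 - ρ t m := by
      rw [key]
      simp [hρT]
    rw [← h2]
    apply intervalIntegral.integral_congr
    intro s hs
    rw [Set.uIcc_of_le ht.2] at hs
    simp only
    rw [hρm s (hst hs)]
end

section
/- Let 0 < s < t ≤ T, fix a constant guidance strength w ∈ ℝ, and let ρ be a reverse-dynamics solution for the constant family (R^{(w)}_τ) on [s, t]. Then ρ s m = ρ t m · ((1 − exp(−σ̄ s))/(1 − exp(−σ̄ t)))^{Z_w}, and for every i ≠ m, ρ s i = ρ t i + ρ t m · (1 − ((1 − exp(−σ̄ s))/(1 − exp(−σ̄ t)))^{Z_w}) · p^{(w)} i. -/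
open Finset

theorem const_of_deriv_zero_aux (f : ℝ → ℝ) (s t : ℝ) (hst : s < t)
    (hc : ContinuousOn f (Set.Icc s t)) (hd : ∀ x ∈ Set.Ioo s t, HasDerivAt f 0 x) :
    f s = f t := by
  obtain ⟨c, _, h⟩ := exists_hasDerivAt_eq_slope f (fun _ => 0) hst hc hd
  have h2 : t - s ≠ 0 := by linarith
  rw [eq_comm, div_eq_zero_iff] at h
  rcases h with h | h
  · linarith
  · exact absurd h h2

/-- Let `0 < s < t ≤ T`, fix a constant guidance strength `w ∈ ℝ`, and let
`ρ` be a reverse-dynamics solution for the constant family `(R^{(w)}_τ)` on `[s, t]`.  Then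
`ρ s m = ρ t m · ((1 - exp(-σ̄ s))/(1 - exp(-σ̄ t)))^{Z_w}`, and for every `i ≠ m`,
`ρ s i = ρ t i + ρ t m · (1 - ((1 - exp(-σ̄ s))/(1 - exp(-σ̄ t)))^{Z_w}) · p^{(w)} i`. -/
theorem guided_reverse_dynamics_constant_guidance
    (M : ℕ) (hM : 2 ≤ M) (m : Fin M) (hm : (m : ℕ) = M - 1)
    (p q : Fin M → ℝ)
    (hp_nonneg : ∀ i, 0 ≤ p i) (hp_sum : ∑ i, p i = 1) (hpm : p m = 0)
    (hp_pos : ∀ i, i ≠ m → 0 < p i)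
    (hq_nonneg : ∀ i, 0 ≤ q i) (hq_sum : ∑ i, q i = 1) (hqm : q m = 0)
    (hq_pos : ∀ i, i ≠ m → 0 < q i)
    (T : ℝ) (hT : 0 < T)
    (σ : ℝ → ℝ) (hσ : Continuous σ) (hσpos : ∀ t, 0 < t → 0 < σ t)
    (w : ℝ) (s t : ℝ) (hs : 0 < s) (hst : s < t) (htT : t ≤ T)
    (ρ : ℝ → Fin M → ℝ)
    (hρ : IsReverseSol (fun τ => guidedRate m p q σ w τ) (Set.Icc s t) ρ) :
    ρ s m = ρ t m *
        ((1 - Real.exp (-(sigmaBar σ s))) / (1 - Real.exp (-(sigmaBar σ t)))) ^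
          Zw m p q w ∧
    ∀ i, i ≠ m →
      ρ s i = ρ t i + ρ t m *
          (1 - ((1 - Real.exp (-(sigmaBar σ s))) / (1 - Real.exp (-(sigmaBar σ t)))) ^
                Zw m p q w) * tilted m p q w i := by
  obtain ⟨hc, hd⟩ := hρ
  rw [interior_Icc] at hd
  have hmv : ∀ τ i, (guidedRate m p q σ w τ).mulVec (ρ τ) i =
      cFun σ τ * Zw m p q w * (if i = m then -1 else tilted m p q w i) * ρ τ m := by
    intro τ i
    simp [guidedRate, Amat, Matrix.mulVec, dotProduct, Matrix.smul_apply]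
  have hdi : ∀ i, ∀ x ∈ Set.Ioo s t, HasDerivAt (fun τ => ρ τ i)
      (-(cFun σ x * Zw m p q w * (if i = m then -1 else tilted m p q w i) * ρ x m)) x := by
    intro i x hx
    have := (hasDerivAt_pi.1 (hd x hx)) i
    rw [Pi.neg_apply, hmv] at this
    exact this
  have hci : ∀ i, ContinuousOn (fun τ => ρ τ i) (Set.Icc s t) := fun i =>
    (continuousOn_pi.1 hc) i
  have hsb : ∀ x, HasDerivAt (sigmaBar σ) (σ x) x := fun x =>
    intervalIntegral.integral_hasDerivAt_right (hσ.intervalIntegrable _ _)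
      (hσ.stronglyMeasurableAtFilter _ _) hσ.continuousAt
  have hsbpos : ∀ x, 0 < x → 0 < sigmaBar σ x := by
    intro x hx
    exact intervalIntegral.intervalIntegral_pos_of_pos_on (hσ.intervalIntegrable _ _)
      (fun y hy => hσpos y hy.1) hx
  have hupos : ∀ x, 0 < x → 0 < 1 - Real.exp (-(sigmaBar σ x)) := by
    intro x hx
    have : Real.exp (-(sigmaBar σ x)) < 1 := Real.exp_lt_one_iff.2 (by linarith [hsbpos x hx])
    linarith
  have hu : ∀ x, HasDerivAt (fun x => 1 - Real.exp (-(sigmaBar σ x)))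
      (σ x * Real.exp (-(sigmaBar σ x))) x := by
    intro x
    have := ((hsb x).neg.exp).const_sub 1
    refine HasDerivAt.congr_deriv (f := fun x => 1 - Real.exp (-(sigmaBar σ x))) this ?_
    change -(Real.exp (-(sigmaBar σ x)) * -σ x) = _
    ring
  have key : ρ s m * (1 - Real.exp (-(sigmaBar σ s))) ^ (-(Zw m p q w)) =
      ρ t m * (1 - Real.exp (-(sigmaBar σ t))) ^ (-(Zw m p q w)) := by
    have hv : ∀ x, 0 < x → HasDerivAt
        (fun x => (1 - Real.exp (-(sigmaBar σ x))) ^ (-(Zw m p q w)))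
        (σ x * Real.exp (-(sigmaBar σ x)) * (-(Zw m p q w)) *
          (1 - Real.exp (-(sigmaBar σ x))) ^ (-(Zw m p q w) - 1)) x := fun x hx =>
      (hu x).rpow_const (Or.inl (hupos x hx).ne')
    refine const_of_deriv_zero_aux
      (fun x => ρ x m * (1 - Real.exp (-(sigmaBar σ x))) ^ (-(Zw m p q w))) s t hst ?_ ?_
    · refine (hci m).mul fun x hx => ?_
      exact (hv x (lt_of_lt_of_le hs hx.1)).continuousAt.continuousWithinAt
    · intro x hx
      have hx0 : 0 < x := hs.trans hx.1
      have h := (hdi m x hx).mul (hv x hx0)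
      refine h.congr_deriv ?_
      have hne := (hupos x hx0).ne'
      rw [Real.rpow_sub_one hne, if_pos rfl, cFun]
      field_simp
      ring
  have hm1 : ρ s m = ρ t m *
        ((1 - Real.exp (-(sigmaBar σ s))) / (1 - Real.exp (-(sigmaBar σ t)))) ^
          Zw m p q w := by
    have h1 := hupos s hs
    have h2 := hupos t (hs.trans hst)
    rw [Real.rpow_neg h1.le, Real.rpow_neg h2.le] at key
    rw [Real.div_rpow h1.le h2.le]
    have h3 := (Real.rpow_pos_of_pos h1 (Zw m p q w)).ne'
    have h4 := (Real.rpow_pos_of_pos h2 (Zw m p q w)).ne'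
    rw [← div_eq_mul_inv, ← div_eq_mul_inv, div_eq_iff h3] at key
    rw [key]
    ring
  refine ⟨hm1, fun i hi => ?_⟩
  have h : ρ s i + tilted m p q w i * ρ s m = ρ t i + tilted m p q w i * ρ t m := by
    refine const_of_deriv_zero_aux
      (fun x => ρ x i + tilted m p q w i * ρ x m) s t hst ?_ ?_
    · exact (hci i).add (continuousOn_const.mul (hci m))
    · intro x hx
      refine ((hdi i x hx).add ((hdi m x hx).const_mul (tilted m p q w i))).congr_deriv ?_
      rw [if_neg hi, if_pos rfl]
      ring
  rw [hm1] at h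
  linear_combination h
end

section
/- Let 0 < s < t ≤ T, fix a constant guidance strength w ∈ ℝ, let ρ be a reverse-dynamics solution for the column-normalized 2D family (R̄_nor^{(w)}_τ) on [s, t], and set r = (1 − exp(−σ̄ s))/(1 − exp(−σ̄ t)). Then: (1) for i, j ≠ m: ρ s (i,j) = ρ t (i,j) + (1 − r)² · p^{(w)}(i,j) · ρ t (m,m) + (1 − r) · [p^{(w)}(X₂=j | X₁=i) · ρ t (i,m) + p^{(w)}(X₁=i | X₂=j) · ρ t (m,j)]; (2) for i ≠ m: ρ s (i,m) = r · ρ t (i,m) + r(1 − r) · p^{(w)}(X₁=i) · ρ t (m,m); (3) for j ≠ m: ρ s (m,j) = r · ρ t (m,j) + r(1 − r) · p^{(w)}(X₂=j) · ρ t (m,m); (4) ρ s (m,m) = r² · ρ t (m,m). -/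
open Finset

noncomputable section Guided2D

variable {M : ℕ}

/-- Partition function `Z_w = ∑_{i,j ≠ m} π(i,j)^w κ(i,j)^{1-w}`. -/
def Zw2 (m : Fin M) (π κ : Fin M × Fin M → ℝ) (w : ℝ) : ℝ :=
  ∑ x ∈ Finset.univ.filter (fun x : Fin M × Fin M => x.1 ≠ m ∧ x.2 ≠ m),
    (π x) ^ w * (κ x) ^ (1 - w)

/-- Tilted two-token distribution `p^{(w)}(i,j) = π(i,j)^w κ(i,j)^{1-w} / Z_w` on pairs with
both coordinates unmasked, and `0` on pairs having a masked coordinate. -/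
def tilted2 (m : Fin M) (π κ : Fin M × Fin M → ℝ) (w : ℝ) : Fin M × Fin M → ℝ :=
  fun x => if x.1 = m ∨ x.2 = m then 0
    else (π x) ^ w * (κ x) ^ (1 - w) / Zw2 m π κ w

/-- First marginal `p^{(w)}(X₁ = i) = ∑_{j ≠ m} p^{(w)}(i, j)`. -/
def marg1 (m : Fin M) (π κ : Fin M × Fin M → ℝ) (w : ℝ) (i : Fin M) : ℝ :=
  ∑ j ∈ Finset.univ.filter (fun j => j ≠ m), tilted2 m π κ w (i, j)

/-- Second marginal `p^{(w)}(X₂ = j) = ∑_{i ≠ m} p^{(w)}(i, j)`. -/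
def marg2 (m : Fin M) (π κ : Fin M × Fin M → ℝ) (w : ℝ) (j : Fin M) : ℝ :=
  ∑ i ∈ Finset.univ.filter (fun i => i ≠ m), tilted2 m π κ w (i, j)

/-- Conditional `p^{(w)}(X₂ = j | X₁ = i) = p^{(w)}(i,j) / p^{(w)}(X₁ = i)`. -/
def cond21 (m : Fin M) (π κ : Fin M × Fin M → ℝ) (w : ℝ) (i j : Fin M) : ℝ :=
  tilted2 m π κ w (i, j) / marg1 m π κ w i

/-- Conditional `p^{(w)}(X₁ = i | X₂ = j) = p^{(w)}(i,j) / p^{(w)}(X₂ = j)`. -/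
def cond12 (m : Fin M) (π κ : Fin M × Fin M → ℝ) (w : ℝ) (i j : Fin M) : ℝ :=
  tilted2 m π κ w (i, j) / marg2 m π κ w j

/-- Number of masked coordinates of a pair. -/
def maskedCount (m : Fin M) (x : Fin M × Fin M) : ℕ :=
  (if x.1 = m then 1 else 0) + (if x.2 = m then 1 else 0)

/-- The column-normalized 2D guided rate matrix `R̄_nor^{(w)}_t` on `Fin M × Fin M`. -/
def guidedRateNor2 (m : Fin M) (π κ : Fin M × Fin M → ℝ) (σ : ℝ → ℝ) (w t : ℝ) :
    Matrix (Fin M × Fin M) (Fin M × Fin M) ℝ :=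
  fun y x =>
    if y = x then -(cFun σ t) * (maskedCount m x : ℝ)
    else if y.1 = x.1 ∧ x.1 ≠ m ∧ x.2 = m ∧ y.2 ≠ m then
      cFun σ t * cond21 m π κ w x.1 y.2
    else if y.2 = x.2 ∧ x.2 ≠ m ∧ x.1 = m ∧ y.1 ≠ m then
      cFun σ t * cond12 m π κ w y.1 x.2
    else if x.1 = m ∧ x.2 = m ∧ y.2 = m ∧ y.1 ≠ m then
      cFun σ t * marg1 m π κ w y.1
    else if x.1 = m ∧ x.2 = m ∧ y.1 = m ∧ y.2 ≠ m then
      cFun σ t * marg2 m π κ w y.2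
    else 0

/-- A reverse-dynamics solution for a family of rate matrices `Rfam` on an interval `I`:
a continuous `ρ` such that, at every `τ` in the interior of `I`, `ρ` has derivative
`-(Rfam τ).mulVec (ρ τ)` at `τ`. -/
def IsReverseSol2 (Rfam : ℝ → Matrix (Fin M × Fin M) (Fin M × Fin M) ℝ) (I : Set ℝ)
    (ρ : ℝ → Fin M × Fin M → ℝ) : Prop :=
  ContinuousOn ρ I ∧ ∀ τ ∈ interior I, HasDerivAt ρ (-((Rfam τ).mulVec (ρ τ))) τ

end Guided2D

theorem mulVec_mm {M : ℕ} (m : Fin M) (π κ : Fin M × Fin M → ℝ) (σ : ℝ → ℝ) (w t : ℝ)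
    (v : Fin M × Fin M → ℝ) :
    (guidedRateNor2 m π κ σ w t).mulVec v (m, m) = -(2 * cFun σ t * v (m, m)) := by
  have h : ∀ x, guidedRateNor2 m π κ σ w t (m, m) x * v x =
      (if x = (m, m) then -(2 * cFun σ t * v (m, m)) else 0) := by
    rintro ⟨a, b⟩
    unfold guidedRateNor2 maskedCount
    simp only [Prod.mk.injEq]
    split_ifs <;> grind
  simp only [Matrix.mulVec, dotProduct, h]
  simp

theorem mulVec_im {M : ℕ} (m : Fin M) (π κ : Fin M × Fin M → ℝ) (σ : ℝ → ℝ) (w t : ℝ)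
    (v : Fin M × Fin M → ℝ) (i : Fin M) (hi : i ≠ m) :
    (guidedRateNor2 m π κ σ w t).mulVec v (i, m) =
      -(cFun σ t * v (i, m)) + cFun σ t * marg1 m π κ w i * v (m, m) := by
  have h : ∀ x, guidedRateNor2 m π κ σ w t (i, m) x * v x =
      (if x = (i, m) then -(cFun σ t * v (i, m)) else 0) +
      (if x = (m, m) then cFun σ t * marg1 m π κ w i * v (m, m) else 0) := by
    rintro ⟨a, b⟩
    unfold guidedRateNor2 maskedCount
    simp only [Prod.mk.injEq]
    split_ifs <;> grind
  simp only [Matrix.mulVec, dotProduct, h, Finset.sum_add_distrib]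
  simp

theorem mulVec_mj {M : ℕ} (m : Fin M) (π κ : Fin M × Fin M → ℝ) (σ : ℝ → ℝ) (w t : ℝ)
    (v : Fin M × Fin M → ℝ) (j : Fin M) (hj : j ≠ m) :
    (guidedRateNor2 m π κ σ w t).mulVec v (m, j) =
      -(cFun σ t * v (m, j)) + cFun σ t * marg2 m π κ w j * v (m, m) := by
  have h : ∀ x, guidedRateNor2 m π κ σ w t (m, j) x * v x =
      (if x = (m, j) then -(cFun σ t * v (m, j)) else 0) +
      (if x = (m, m) then cFun σ t * marg2 m π κ w j * v (m, m) else 0) := by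
    rintro ⟨a, b⟩
    unfold guidedRateNor2 maskedCount
    simp only [Prod.mk.injEq]
    split_ifs <;> grind
  simp only [Matrix.mulVec, dotProduct, h, Finset.sum_add_distrib]
  simp

theorem mulVec_ij {M : ℕ} (m : Fin M) (π κ : Fin M × Fin M → ℝ) (σ : ℝ → ℝ) (w t : ℝ)
    (v : Fin M × Fin M → ℝ) (i j : Fin M) (hi : i ≠ m) (hj : j ≠ m) :
    (guidedRateNor2 m π κ σ w t).mulVec v (i, j) =
      cFun σ t * cond21 m π κ w i j * v (i, m) + cFun σ t * cond12 m π κ w i j * v (m, j) := by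
  have h : ∀ x, guidedRateNor2 m π κ σ w t (i, j) x * v x =
      (if x = (i, m) then cFun σ t * cond21 m π κ w i j * v (i, m) else 0) +
      (if x = (m, j) then cFun σ t * cond12 m π κ w i j * v (m, j) else 0) := by
    rintro ⟨a, b⟩
    unfold guidedRateNor2 maskedCount
    simp only [Prod.mk.injEq]
    split_ifs <;> grind
  simp only [Matrix.mulVec, dotProduct, h, Finset.sum_add_distrib]
  simp

theorem E_pos (σ : ℝ → ℝ) (hσ : Continuous σ) (hσpos : ∀ t, 0 < t → 0 < σ t) (τ : ℝ)
    (hτ : 0 < τ) : 0 < 1 - Real.exp (-(sigmaBar σ τ)) := by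
  have h : 0 < sigmaBar σ τ := by
    unfold sigmaBar
    exact intervalIntegral.intervalIntegral_pos_of_pos_on (hσ.intervalIntegrable _ _)
      (fun x hx => hσpos x hx.1) hτ
  have : Real.exp (-(sigmaBar σ τ)) < 1 := by
    rw [Real.exp_lt_one_iff]; linarith
  linarith

theorem E_deriv (σ : ℝ → ℝ) (hσ : Continuous σ) (τ : ℝ) :
    HasDerivAt (fun τ => 1 - Real.exp (-(sigmaBar σ τ)))
      (σ τ * Real.exp (-(sigmaBar σ τ))) τ := by
  have h : HasDerivAt (sigmaBar σ) (σ τ) τ := by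
    unfold sigmaBar
    exact intervalIntegral.integral_hasDerivAt_right (hσ.intervalIntegrable _ _)
      (hσ.stronglyMeasurableAtFilter _ _) hσ.continuousAt
  have := (h.neg.exp).const_sub 1
  refine HasDerivAt.congr_deriv this ?_
  simp
  ring

theorem lin_ode (σ : ℝ → ℝ) (hσ : Continuous σ) (hσpos : ∀ t, 0 < t → 0 < σ t)
    (s t : ℝ) (hs : 0 < s) (hst : s < t) (r : ℝ)
    (hr : r = (1 - Real.exp (-(sigmaBar σ s))) / (1 - Real.exp (-(sigmaBar σ t))))
    (n : ℕ) (f : ℝ → ℝ) (hf : ContinuousOn f (Set.Icc s t))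
    (hd : ∀ τ ∈ Set.Ioo s t, HasDerivAt f (n * cFun σ τ * f τ) τ) :
    f s = r ^ n * f t := by
  have hE : ∀ τ ∈ Set.Icc s t, 0 < 1 - Real.exp (-(sigmaBar σ τ)) :=
    fun τ h => E_pos σ hσ hσpos τ (lt_of_lt_of_le hs h.1)
  have hEd := E_deriv σ hσ
  set E := fun τ => 1 - Real.exp (-(sigmaBar σ τ)) with hEdef
  have hEc : ContinuousOn E (Set.Icc s t) := fun τ _ => (hEd τ).continuousAt.continuousWithinAt
  obtain ⟨x, hx, hx'⟩ := exists_hasDerivAt_eq_slope (fun τ => f τ / E τ ^ n) (fun _ => 0) hst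
    (hf.div (hEc.pow n) (fun τ h => pow_ne_zero _ (hE τ h).ne'))
    (by
      intro τ hτ
      have hp : E τ ≠ 0 := (hE τ (Set.Ioo_subset_Icc_self hτ)).ne'
      have := (hd τ hτ).div ((hEd τ).pow n) (pow_ne_zero _ hp)
      refine this.congr_deriv ?_
      have hc : cFun σ τ = σ τ * Real.exp (-(sigmaBar σ τ)) / E τ := rfl
      rw [hc]
      rcases n with _ | n
      · simp
      · simp only [Pi.pow_apply, Nat.add_sub_cancel]
        field_simp
        ring)
  have h0 : f t / E t ^ n = f s / E s ^ n := by
    have : t - s ≠ 0 := by linarith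
    field_simp at hx'
    linarith
  have hs' : E s ≠ 0 := (hE s ⟨le_rfl, hst.le⟩).ne'
  have ht' : E t ≠ 0 := (hE t ⟨hst.le, le_rfl⟩).ne'
  have hr' : r = E s / E t := hr
  rw [hr', div_pow]
  field_simp at h0 ⊢
  linarith

theorem Zw2_pos {M : ℕ} (m : Fin M) (π κ : Fin M × Fin M → ℝ) (w : ℝ)
    (hπ_pos : ∀ x : Fin M × Fin M, x.1 ≠ m → x.2 ≠ m → 0 < π x)
    (hκ_pos : ∀ x : Fin M × Fin M, x.1 ≠ m → x.2 ≠ m → 0 < κ x)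
    (i : Fin M) (hi : i ≠ m) : 0 < Zw2 m π κ w := by
  unfold Zw2
  apply Finset.sum_pos
  · intro x hx
    simp only [Finset.mem_filter, Finset.mem_univ, true_and] at hx
    exact mul_pos (Real.rpow_pos_of_pos (hπ_pos x hx.1 hx.2) _)
      (Real.rpow_pos_of_pos (hκ_pos x hx.1 hx.2) _)
  · exact ⟨(i, i), by simp [hi]⟩

theorem tilted2_pos {M : ℕ} (m : Fin M) (π κ : Fin M × Fin M → ℝ) (w : ℝ)
    (hπ_pos : ∀ x : Fin M × Fin M, x.1 ≠ m → x.2 ≠ m → 0 < π x)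
    (hκ_pos : ∀ x : Fin M × Fin M, x.1 ≠ m → x.2 ≠ m → 0 < κ x)
    (i j : Fin M) (hi : i ≠ m) (hj : j ≠ m) : 0 < tilted2 m π κ w (i, j) := by
  simp only [tilted2, hi, hj, or_self, if_false]
  exact div_pos (mul_pos (Real.rpow_pos_of_pos (hπ_pos _ hi hj) _)
      (Real.rpow_pos_of_pos (hκ_pos _ hi hj) _)) (Zw2_pos m π κ w hπ_pos hκ_pos i hi)

/-- Let `0 < s < t ≤ T`, fix a constant guidance strength `w ∈ ℝ`, let `ρ`
be a reverse-dynamics solution for the column-normalized 2D family `(R̄_nor^{(w)}_τ)` on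
`[s, t]`, and set `r = (1 - exp(-σ̄ s))/(1 - exp(-σ̄ t))`.  Then the four formulas of
Theorem `2d-interval-constant` hold. -/
theorem normalized_guided_reverse_dynamics_2d
    (M : ℕ) (hM : 2 ≤ M) (m : Fin M) (hm : (m : ℕ) = M - 1)
    (π κ : Fin M × Fin M → ℝ)
    (hπ_nonneg : ∀ x, 0 ≤ π x) (hπ_sum : ∑ x, π x = 1)
    (hπ_zero : ∀ x : Fin M × Fin M, x.1 = m ∨ x.2 = m → π x = 0)
    (hπ_pos : ∀ x : Fin M × Fin M, x.1 ≠ m → x.2 ≠ m → 0 < π x)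
    (hκ_nonneg : ∀ x, 0 ≤ κ x) (hκ_sum : ∑ x, κ x = 1)
    (hκ_zero : ∀ x : Fin M × Fin M, x.1 = m ∨ x.2 = m → κ x = 0)
    (hκ_pos : ∀ x : Fin M × Fin M, x.1 ≠ m → x.2 ≠ m → 0 < κ x)
    (T : ℝ) (hT : 0 < T)
    (σ : ℝ → ℝ) (hσ : Continuous σ) (hσpos : ∀ t, 0 < t → 0 < σ t)
    (w : ℝ) (s t : ℝ) (hs : 0 < s) (hst : s < t) (htT : t ≤ T)
    (ρ : ℝ → Fin M × Fin M → ℝ)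
    (hρ : IsReverseSol2 (fun τ => guidedRateNor2 m π κ σ w τ) (Set.Icc s t) ρ)
    (r : ℝ)
    (hr : r = (1 - Real.exp (-(sigmaBar σ s))) / (1 - Real.exp (-(sigmaBar σ t)))) :
    (∀ i j : Fin M, i ≠ m → j ≠ m →
      ρ s (i, j) = ρ t (i, j) + (1 - r) ^ 2 * tilted2 m π κ w (i, j) * ρ t (m, m) +
        (1 - r) * (cond21 m π κ w i j * ρ t (i, m) + cond12 m π κ w i j * ρ t (m, j))) ∧
    (∀ i : Fin M, i ≠ m →
      ρ s (i, m) = r * ρ t (i, m) + r * (1 - r) * marg1 m π κ w i * ρ t (m, m)) ∧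
    (∀ j : Fin M, j ≠ m →
      ρ s (m, j) = r * ρ t (m, j) + r * (1 - r) * marg2 m π κ w j * ρ t (m, m)) ∧
    ρ s (m, m) = r ^ 2 * ρ t (m, m) := by
  obtain ⟨hc, hd⟩ := hρ
  rw [interior_Icc] at hd
  have hcx : ∀ x, ContinuousOn (fun τ => ρ τ x) (Set.Icc s t) := fun x =>
    (continuous_apply x).comp_continuousOn hc
  have hdx : ∀ x, ∀ τ ∈ Set.Ioo s t, HasDerivAt (fun τ => ρ τ x)
      (-((guidedRateNor2 m π κ σ w τ).mulVec (ρ τ) x)) τ := fun x τ h =>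
    (hasDerivAt_pi.1 (hd τ h)) x
  have key := lin_ode σ hσ hσpos s t hs hst r hr
  have h4 : ρ s (m, m) = r ^ 2 * ρ t (m, m) := by
    refine key 2 (fun τ => ρ τ (m, m)) (hcx _) fun τ h => (hdx _ τ h).congr_deriv ?_
    rw [mulVec_mm]; push_cast; ring
  have h2 : ∀ i : Fin M, i ≠ m →
      ρ s (i, m) = r * ρ t (i, m) + r * (1 - r) * marg1 m π κ w i * ρ t (m, m) := by
    intro i hi
    have := key 1 (fun τ => ρ τ (i, m) + marg1 m π κ w i * ρ τ (m, m))
      ((hcx _).add (continuousOn_const.mul (hcx _)))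
      fun τ h => ((hdx _ τ h).add ((hdx _ τ h).const_mul _)).congr_deriv (by
        rw [mulVec_mm, mulVec_im _ _ _ _ _ _ _ _ hi]; push_cast; ring)
    simp only [h4] at this
    linear_combination this
  have h3 : ∀ j : Fin M, j ≠ m →
      ρ s (m, j) = r * ρ t (m, j) + r * (1 - r) * marg2 m π κ w j * ρ t (m, m) := by
    intro j hj
    have := key 1 (fun τ => ρ τ (m, j) + marg2 m π κ w j * ρ τ (m, m))
      ((hcx _).add (continuousOn_const.mul (hcx _)))
      fun τ h => ((hdx _ τ h).add ((hdx _ τ h).const_mul _)).congr_deriv (by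
        rw [mulVec_mm, mulVec_mj _ _ _ _ _ _ _ _ hj]; push_cast; ring)
    simp only [h4] at this
    linear_combination this
  refine ⟨?_, h2, h3, h4⟩
  intro i j hi hj
  have hp := tilted2_pos m π κ w hπ_pos hκ_pos
  have ha : cond21 m π κ w i j * marg1 m π κ w i = tilted2 m π κ w (i, j) := by
    have : 0 < marg1 m π κ w i :=
      Finset.sum_pos (fun k hk => hp i k hi (by simpa using hk)) ⟨i, by simp [hi]⟩
    exact div_mul_cancel₀ _ this.ne'
  have hb : cond12 m π κ w i j * marg2 m π κ w j = tilted2 m π κ w (i, j) := by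
    have : 0 < marg2 m π κ w j :=
      Finset.sum_pos (fun k hk => hp k j (by simpa using hk) hj) ⟨i, by simp [hi]⟩
    exact div_mul_cancel₀ _ this.ne'
  have := key 0 (fun τ => ρ τ (i, j) + cond21 m π κ w i j * ρ τ (i, m) +
      cond12 m π κ w i j * ρ τ (m, j) + tilted2 m π κ w (i, j) * ρ τ (m, m))
    ((((hcx _).add (continuousOn_const.mul (hcx _))).add (continuousOn_const.mul (hcx _))).add
      (continuousOn_const.mul (hcx _)))
    fun τ h => ((((hdx _ τ h).add ((hdx _ τ h).const_mul _)).add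
      ((hdx _ τ h).const_mul _)).add ((hdx _ τ h).const_mul _)).congr_deriv (by
        rw [mulVec_mm, mulVec_im _ _ _ _ _ _ _ _ hi, mulVec_mj _ _ _ _ _ _ _ _ hj,
          mulVec_ij _ _ _ _ _ _ _ _ _ hi hj]
        push_cast
        linear_combination (-cFun σ τ * ρ τ (m, m)) * ha + (-cFun σ τ * ρ τ (m, m)) * hb)
  simp only [h4, h2 i hi, h3 j hj] at this
  linear_combination this - r * (1 - r) * ρ t (m, m) * ha - r * (1 - r) * ρ t (m, m) * hb
end

section
/- Suppose σ̄ t = −log(1 − δ·t) for some δ > 0 (i.e. σ t = δ/(1 − δ·t)) and 0 < s < t ≤ T < 1/δ. Fix a constant guidance strength w ∈ ℝ and let ρ be a reverse-dynamics solution for the column-normalized 2D family (R̄_nor^{(w)}_τ) on [s, t]. Then: (1) for i, j ≠ m: ρ s (i,j) = ρ t (i,j) + ((t−s)/t)² · p^{(w)}(i,j) · ρ t (m,m) + ((t−s)/t) · [p^{(w)}(X₂=j | X₁=i) · ρ t (i,m) + p^{(w)}(X₁=i | X₂=j) · ρ t (m,j)]; (2) for i ≠ m: ρ s (i,m) = (s/t)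 · ρ t (i,m) + (s/t)·((t−s)/t) · p^{(w)}(X₁=i) · ρ t (m,m); (3) for j ≠ m: ρ s (m,j) = (s/t) · ρ t (m,j) + (s/t)·((t−s)/t) · p^{(w)}(X₂=j) · ρ t (m,m); (4) ρ s (m,m) = (s/t)² · ρ t (m,m). -/
open Finset

lemma g2_const (f f' : ℝ → ℝ) (s t : ℝ) (hst : s < t) (hc : ContinuousOn f (Set.Icc s t))
    (hd : ∀ x ∈ Set.Ioo s t, HasDerivAt f (f' x) x) (h0 : ∀ x ∈ Set.Ioo s t, f' x = 0) :
    f s = f t := by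
  obtain ⟨c, hcm, h⟩ := exists_hasDerivAt_eq_slope f f' hst hc hd
  rw [h0 c hcm, eq_comm, div_eq_zero_iff] at h
  rcases h with h | h <;> linarith

lemma g2_tilted_nonneg {M : ℕ} (m : Fin M) (π κ : Fin M × Fin M → ℝ)
    (hπ : ∀ x, 0 ≤ π x) (hκ : ∀ x, 0 ≤ κ x) (w : ℝ) (x : Fin M × Fin M) :
    0 ≤ tilted2 m π κ w x := by
  have hz : 0 ≤ Zw2 m π κ w := Finset.sum_nonneg fun x _ =>
    mul_nonneg (Real.rpow_nonneg (hπ x) _) (Real.rpow_nonneg (hκ x) _)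
  unfold tilted2
  split_ifs
  · exact le_rfl
  · exact div_nonneg (mul_nonneg (Real.rpow_nonneg (hπ x) _) (Real.rpow_nonneg (hκ x) _)) hz

lemma g2_c21 {M : ℕ} (m : Fin M) (π κ : Fin M × Fin M → ℝ)
    (hπ : ∀ x, 0 ≤ π x) (hκ : ∀ x, 0 ≤ κ x) (w : ℝ) (i j : Fin M) (hj : j ≠ m) :
    cond21 m π κ w i j * marg1 m π κ w i = tilted2 m π κ w (i, j) := by
  unfold cond21
  refine div_mul_cancel_of_imp fun h => ?_
  unfold marg1 at h
  rw [Finset.sum_eq_zero_iff_of_nonneg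
    (fun j _ => g2_tilted_nonneg m π κ hπ hκ w (i, j))] at h
  exact h j (by simp [hj])

lemma g2_c12 {M : ℕ} (m : Fin M) (π κ : Fin M × Fin M → ℝ)
    (hπ : ∀ x, 0 ≤ π x) (hκ : ∀ x, 0 ≤ κ x) (w : ℝ) (i j : Fin M) (hi : i ≠ m) :
    cond12 m π κ w i j * marg2 m π κ w j = tilted2 m π κ w (i, j) := by
  unfold cond12
  refine div_mul_cancel_of_imp fun h => ?_
  unfold marg2 at h
  rw [Finset.sum_eq_zero_iff_of_nonneg
    (fun i _ => g2_tilted_nonneg m π κ hπ hκ w (i, j))] at h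
  exact h i (by simp [hi])

lemma g2_sum {M : ℕ} (R v : Fin M × Fin M → ℝ) (a b : Fin M × Fin M) (A B : ℝ)
    (h : ∀ x, R x = (if x = a then A else 0) + (if x = b then B else 0)) :
    ∑ x, R x * v x = A * v a + B * v b := by
  simp [h, add_mul, Finset.sum_add_distrib, ite_mul]

section
variable {M : ℕ} (m : Fin M) (π κ : Fin M × Fin M → ℝ) (σ : ℝ → ℝ) (w τ : ℝ)
  (v : Fin M × Fin M → ℝ)

lemma g2_row_mm : (guidedRateNor2 m π κ σ w τ).mulVec v (m, m) = -2 * cFun σ τ * v (m, m) := by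
  have := g2_sum (guidedRateNor2 m π κ σ w τ (m, m)) v (m, m) (m, m) (-2 * cFun σ τ) 0 (by
    rintro ⟨a, b⟩
    by_cases ha : a = m <;> by_cases hb : b = m <;>
      simp [guidedRateNor2, maskedCount, Prod.ext_iff, ha, hb, Ne.symm, eq_comm] <;> grind)
  simpa [Matrix.mulVec, dotProduct] using this

lemma g2_row_im (i : Fin M) (hi : i ≠ m) : (guidedRateNor2 m π κ σ w τ).mulVec v (i, m) =
    -cFun σ τ * v (i, m) + cFun σ τ * marg1 m π κ w i * v (m, m) := by
  refine g2_sum (guidedRateNor2 m π κ σ w τ (i, m)) v (i, m) (m, m) _ _ ?_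
  rintro ⟨a, b⟩
  simp only [guidedRateNor2, maskedCount, Prod.ext_iff]
  by_cases ha : a = m <;> by_cases hb : b = m <;> by_cases hc : a = i <;> simp_all <;> grind

lemma g2_row_mj (j : Fin M) (hj : j ≠ m) : (guidedRateNor2 m π κ σ w τ).mulVec v (m, j) =
    -cFun σ τ * v (m, j) + cFun σ τ * marg2 m π κ w j * v (m, m) := by
  refine g2_sum (guidedRateNor2 m π κ σ w τ (m, j)) v (m, j) (m, m) _ _ ?_
  rintro ⟨a, b⟩
  simp only [guidedRateNor2, maskedCount, Prod.ext_iff]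
  by_cases ha : a = m <;> by_cases hb : b = m <;> by_cases hc : b = j <;> simp_all <;> grind

lemma g2_row_ij (i j : Fin M) (hi : i ≠ m) (hj : j ≠ m) :
    (guidedRateNor2 m π κ σ w τ).mulVec v (i, j) =
    cFun σ τ * cond21 m π κ w i j * v (i, m) + cFun σ τ * cond12 m π κ w i j * v (m, j) := by
  refine g2_sum (guidedRateNor2 m π κ σ w τ (i, j)) v (i, m) (m, j) _ _ ?_
  rintro ⟨a, b⟩
  simp only [guidedRateNor2, maskedCount, Prod.ext_iff]
  by_cases ha : a = m <;> by_cases hb : b = m <;> by_cases hc : b = j <;>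
    by_cases hd : a = i <;> simp_all <;> grind

end

/-- Suppose `σ̄ t = -log (1 - δ t)` for some `δ > 0` (i.e.
`σ t = δ / (1 - δ t)`) and `0 < s < t ≤ T < 1/δ`.  Fix a constant guidance strength `w ∈ ℝ`
and let `ρ` be a reverse-dynamics solution for the column-normalized 2D family
`(R̄_nor^{(w)}_τ)` on `[s, t]`.  Then the four formulas hold with the ratio
`(1 - exp(-σ̄ s))/(1 - exp(-σ̄ t))` replaced by `s/t`. -/
theorem normalized_guided_reverse_dynamics_2d_loglinear
    (M : ℕ) (hM : 2 ≤ M) (m : Fin M) (hm : (m : ℕ) = M - 1)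
    (π κ : Fin M × Fin M → ℝ)
    (hπ_nonneg : ∀ x, 0 ≤ π x) (hπ_sum : ∑ x, π x = 1)
    (hπ_zero : ∀ x : Fin M × Fin M, x.1 = m ∨ x.2 = m → π x = 0)
    (hπ_pos : ∀ x : Fin M × Fin M, x.1 ≠ m → x.2 ≠ m → 0 < π x)
    (hκ_nonneg : ∀ x, 0 ≤ κ x) (hκ_sum : ∑ x, κ x = 1)
    (hκ_zero : ∀ x : Fin M × Fin M, x.1 = m ∨ x.2 = m → κ x = 0)
    (hκ_pos : ∀ x : Fin M × Fin M, x.1 ≠ m → x.2 ≠ m → 0 < κ x)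
    (δ : ℝ) (hδ : 0 < δ)
    (σ : ℝ → ℝ) (hσ : ∀ u, σ u = δ / (1 - δ * u))
    (hσbar : ∀ u, 0 ≤ u → u < 1 / δ → sigmaBar σ u = -Real.log (1 - δ * u))
    (T : ℝ) (hT : 0 < T) (hTδ : T < 1 / δ)
    (w : ℝ) (s t : ℝ) (hs : 0 < s) (hst : s < t) (htT : t ≤ T)
    (ρ : ℝ → Fin M × Fin M → ℝ)
    (hρ : IsReverseSol2 (fun τ => guidedRateNor2 m π κ σ w τ) (Set.Icc s t) ρ) :
    (∀ i j : Fin M, i ≠ m → j ≠ m →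
      ρ s (i, j) = ρ t (i, j) + ((t - s) / t) ^ 2 * tilted2 m π κ w (i, j) * ρ t (m, m) +
        ((t - s) / t) *
          (cond21 m π κ w i j * ρ t (i, m) + cond12 m π κ w i j * ρ t (m, j))) ∧
    (∀ i : Fin M, i ≠ m →
      ρ s (i, m) = (s / t) * ρ t (i, m) +
        (s / t) * ((t - s) / t) * marg1 m π κ w i * ρ t (m, m)) ∧
    (∀ j : Fin M, j ≠ m →
      ρ s (m, j) = (s / t) * ρ t (m, j) +
        (s / t) * ((t - s) / t) * marg2 m π κ w j * ρ t (m, m)) ∧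
    ρ s (m, m) = (s / t) ^ 2 * ρ t (m, m) := by
  obtain ⟨hcont, hder⟩ := hρ
  rw [interior_Icc] at hder
  have ht : 0 < t := hs.trans hst
  have hcF : ∀ τ ∈ Set.Ioo s t, cFun σ τ = 1 / τ := by
    intro τ hτ
    have h0 : 0 < τ := hs.trans hτ.1
    have h1 : τ < 1 / δ := by linarith [hτ.2]
    have h2 : 0 < 1 - δ * τ := by
      rw [lt_div_iff₀ hδ] at h1; linarith
    unfold cFun
    rw [hσbar τ h0.le h1, neg_neg, Real.exp_log h2, hσ, div_mul_cancel₀ _ h2.ne']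
    have : 1 - (1 - δ * τ) = δ * τ := by ring
    rw [this]
    field_simp
  have hC : ∀ x, ContinuousOn (fun τ => ρ τ x) (Set.Icc s t) :=
    fun x => continuousOn_pi.1 hcont x
  have hD : ∀ x, ∀ τ ∈ Set.Ioo s t, HasDerivAt (fun τ => ρ τ x)
      (-((guidedRateNor2 m π κ σ w τ).mulVec (ρ τ) x)) τ :=
    fun x τ hτ => hasDerivAt_pi.1 (hder τ hτ) x
  have hne : ∀ τ ∈ Set.Icc s t, τ ≠ 0 := fun τ hτ => (hs.trans_le hτ.1).ne'
  have hne2 : ∀ τ ∈ Set.Icc s t, τ ^ 2 ≠ 0 := fun τ hτ => pow_ne_zero 2 (hne τ hτ)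
  have h4 : ρ s (m, m) = (s / t) ^ 2 * ρ t (m, m) := by
    have := g2_const (fun τ => ρ τ (m, m) / τ ^ 2) _ s t hst
      ((hC (m, m)).div (by fun_prop) hne2)
      (fun τ hτ => (hD (m, m) τ hτ).div (hasDerivAt_pow 2 τ) (hne2 τ ⟨hτ.1.le, hτ.2.le⟩))
      (fun τ hτ => by
        have h0 := hne τ ⟨hτ.1.le, hτ.2.le⟩
        rw [g2_row_mm, hcF τ hτ]
        field_simp
        ring)
    field_simp at this ⊢
    linarith
  have h2 : ∀ i : Fin M, i ≠ m → ρ s (i, m) = (s / t) * ρ t (i, m) +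
        (s / t) * ((t - s) / t) * marg1 m π κ w i * ρ t (m, m) := by
    intro i hi
    have := g2_const (fun τ => (ρ τ (i, m) + marg1 m π κ w i * ρ τ (m, m)) / τ) _ s t hst
      (((hC (i, m)).add (continuousOn_const.mul (hC (m, m)))).div continuousOn_id hne)
      (fun τ hτ => ((hD (i, m) τ hτ).add ((hD (m, m) τ hτ).const_mul _)).div (hasDerivAt_id τ)
        (hne τ ⟨hτ.1.le, hτ.2.le⟩))
      (fun τ hτ => by
        have h0 := hne τ ⟨hτ.1.le, hτ.2.le⟩
        simp only [id, Pi.add_apply]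
        rw [g2_row_mm, g2_row_im _ _ _ _ _ _ _ _ hi, hcF τ hτ]
        field_simp
        ring)
    simp only [h4] at this
    field_simp at this ⊢
    linarith
  have h3 : ∀ j : Fin M, j ≠ m → ρ s (m, j) = (s / t) * ρ t (m, j) +
        (s / t) * ((t - s) / t) * marg2 m π κ w j * ρ t (m, m) := by
    intro j hj
    have := g2_const (fun τ => (ρ τ (m, j) + marg2 m π κ w j * ρ τ (m, m)) / τ) _ s t hst
      (((hC (m, j)).add (continuousOn_const.mul (hC (m, m)))).div continuousOn_id hne)
      (fun τ hτ => ((hD (m, j) τ hτ).add ((hD (m, m) τ hτ).const_mul _)).div (hasDerivAt_id τ)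
        (hne τ ⟨hτ.1.le, hτ.2.le⟩))
      (fun τ hτ => by
        have h0 := hne τ ⟨hτ.1.le, hτ.2.le⟩
        simp only [id, Pi.add_apply]
        rw [g2_row_mm, g2_row_mj _ _ _ _ _ _ _ _ hj, hcF τ hτ]
        field_simp
        ring)
    simp only [h4] at this
    field_simp at this ⊢
    linarith
  refine ⟨?_, h2, h3, h4⟩
  intro i j hi hj
  have e1 := g2_c21 m π κ hπ_nonneg hκ_nonneg w i j hj
  have e2 := g2_c12 m π κ hπ_nonneg hκ_nonneg w i j hi
  have := g2_const (fun τ => ρ τ (i, j) + cond21 m π κ w i j * ρ τ (i, m) +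
      cond12 m π κ w i j * ρ τ (m, j) + tilted2 m π κ w (i, j) * ρ τ (m, m)) _ s t hst
    ((((hC (i, j)).add (continuousOn_const.mul (hC (i, m)))).add
      (continuousOn_const.mul (hC (m, j)))).add (continuousOn_const.mul (hC (m, m))))
    (fun τ hτ => (((hD (i, j) τ hτ).add ((hD (i, m) τ hτ).const_mul _)).add
      ((hD (m, j) τ hτ).const_mul _)).add ((hD (m, m) τ hτ).const_mul _))
    (fun τ hτ => by
      rw [g2_row_mm, g2_row_mj _ _ _ _ _ _ _ _ hj, g2_row_im _ _ _ _ _ _ _ _ hi,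
        g2_row_ij _ _ _ _ _ _ _ _ _ hi hj]
      linear_combination (-cFun σ τ * ρ τ (m, m)) * e1 + (-cFun σ τ * ρ τ (m, m)) * e2)
  simp only [h4, h2 i hi, h3 j hj] at this
  have hr : (t - s) / t = 1 - s / t := by field_simp
  rw [hr] at this ⊢
  generalize s / t = r at this ⊢
  linear_combination this - r * (1 - r) * ρ t (m, m) * e1 - r * (1 - r) * ρ t (m, m) * e2
end

section
/- Suppose σ̄ t = −log(1 − δ·t) for some δ ∈ (0,1), and let 0 = t_0 < t_1 < t_2 < t_3 = 1 be a time partition with guidance strengths w_0, w_1, w_2 ∈ ℝ on the respective intervals. Let ρ : ℝ → (Fin M × Fin M → ℝ) be continuous on [0,1] with ρ 1 equal to the indicator of the fully masked state (m,m), and suppose that for each i ∈ {0,1,2}, ρ is a reverse-dynamics solution for the column-normalized 2D family (R̄_nor^{(w_i)}_τ) on (t_i, t_{i+1}). Then for all i, j ≠ m: ρ 0 (i,j) = (1−t_2)² · p^{(w_2)}(i,j) + (t_2−t_1)² · p^{(w_1)}(i,j) + t_1² · p^{(w_0)}(i,j) + (1−t_2)(t_2−t_1) · p^{(w_1,w_2)}(i,j)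 + (1−t_2)·t_1 · p^{(w_0,w_2)}(i,j) + (t_2−t_1)·t_1 · p^{(w_0,w_1)}(i,j), where p^{(w,γ)}(i,j) = p^{(w)}(X₂=j | X₁=i) · p^{(γ)}(X₁=i) + p^{(w)}(X₁=i | X₂=j) · p^{(γ)}(X₂=j). -/
open Finset

/-- The combined distribution
`p^{(w,γ)}(i,j) = p^{(w)}(X₂=j | X₁=i) · p^{(γ)}(X₁=i) + p^{(w)}(X₁=i | X₂=j) · p^{(γ)}(X₂=j)`. -/
noncomputable def combined {M : ℕ} (m : Fin M) (π κ : Fin M × Fin M → ℝ)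
    (w γ : ℝ) (i j : Fin M) : ℝ :=
  cond21 m π κ w i j * marg1 m π κ γ i + cond12 m π κ w i j * marg2 m π κ γ j

lemma aux_const {f : ℝ → ℝ} {a b : ℝ} (hab : a ≤ b) (hf : ContinuousOn f (Set.Icc a b))
    (hd : ∀ x ∈ Set.Ioo a b, HasDerivAt f 0 x) : f a = f b := by
  rcases hab.eq_or_lt with rfl | h
  · rfl
  · obtain ⟨c, hc, h2⟩ := exists_hasDerivAt_eq_slope f (fun _ => 0) h hf hd
    have : b - a ≠ 0 := by linarith
    field_simp at h2
    linarith

lemma row_mm {M : ℕ} (m : Fin M) (π κ : Fin M × Fin M → ℝ) (σ : ℝ → ℝ) (w t : ℝ)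
    (v : Fin M × Fin M → ℝ) :
    (guidedRateNor2 m π κ σ w t).mulVec v (m, m) = -2 * cFun σ t * v (m, m) := by
  have h : ∀ x, guidedRateNor2 m π κ σ w t (m, m) x * v x =
      if x = (m, m) then -2 * cFun σ t * v (m, m) else 0 := by
    rintro ⟨x, y⟩
    simp only [guidedRateNor2, maskedCount, Prod.mk.injEq, Nat.cast_add, Nat.cast_ite, Nat.cast_one,
      Nat.cast_zero]
    by_cases hx : x = m <;> by_cases hy : y = m <;> grind
  simp only [Matrix.mulVec, dotProduct, h]
  simp

lemma row_im {M : ℕ} (m : Fin M) (π κ : Fin M × Fin M → ℝ) (σ : ℝ → ℝ) (w t : ℝ)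
    (v : Fin M × Fin M → ℝ) (i : Fin M) (hi : i ≠ m) :
    (guidedRateNor2 m π κ σ w t).mulVec v (i, m) =
      cFun σ t * (marg1 m π κ w i * v (m, m) - v (i, m)) := by
  have h : ∀ x, guidedRateNor2 m π κ σ w t (i, m) x * v x =
      (if x = (m, m) then cFun σ t * marg1 m π κ w i * v (m, m) else 0) +
      (if x = (i, m) then - cFun σ t * v (i, m) else 0) := by
    rintro ⟨x, y⟩
    simp only [guidedRateNor2, maskedCount, Prod.mk.injEq, Nat.cast_add, Nat.cast_ite, Nat.cast_one,
      Nat.cast_zero]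
    by_cases hx : x = m <;> by_cases hy : y = m <;> by_cases hz : x = i <;> grind
  simp only [Matrix.mulVec, dotProduct, h, Finset.sum_add_distrib]
  simp
  ring

lemma row_mj {M : ℕ} (m : Fin M) (π κ : Fin M × Fin M → ℝ) (σ : ℝ → ℝ) (w t : ℝ)
    (v : Fin M × Fin M → ℝ) (j : Fin M) (hj : j ≠ m) :
    (guidedRateNor2 m π κ σ w t).mulVec v (m, j) =
      cFun σ t * (marg2 m π κ w j * v (m, m) - v (m, j)) := by
  have h : ∀ x, guidedRateNor2 m π κ σ w t (m, j) x * v x =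
      (if x = (m, m) then cFun σ t * marg2 m π κ w j * v (m, m) else 0) +
      (if x = (m, j) then - cFun σ t * v (m, j) else 0) := by
    rintro ⟨x, y⟩
    simp only [guidedRateNor2, maskedCount, Prod.mk.injEq, Nat.cast_add, Nat.cast_ite, Nat.cast_one,
      Nat.cast_zero]
    by_cases hx : x = m <;> by_cases hy : y = m <;> by_cases hz : y = j <;> grind
  simp only [Matrix.mulVec, dotProduct, h, Finset.sum_add_distrib]
  simp
  ring

lemma row_ij {M : ℕ} (m : Fin M) (π κ : Fin M × Fin M → ℝ) (σ : ℝ → ℝ) (w t : ℝ)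
    (v : Fin M × Fin M → ℝ) (i j : Fin M) (hi : i ≠ m) (hj : j ≠ m) :
    (guidedRateNor2 m π κ σ w t).mulVec v (i, j) =
      cFun σ t * (cond21 m π κ w i j * v (i, m) + cond12 m π κ w i j * v (m, j)) := by
  have h : ∀ x, guidedRateNor2 m π κ σ w t (i, j) x * v x =
      (if x = (i, m) then cFun σ t * cond21 m π κ w i j * v (i, m) else 0) +
      (if x = (m, j) then cFun σ t * cond12 m π κ w i j * v (m, j) else 0) := by
    rintro ⟨x, y⟩
    simp only [guidedRateNor2, maskedCount, Prod.mk.injEq, Nat.cast_add, Nat.cast_ite, Nat.cast_one,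
      Nat.cast_zero]
    by_cases hx : x = m <;> by_cases hy : y = m <;> by_cases hz : y = j <;>
      by_cases hu : x = i <;> grind
  simp only [Matrix.mulVec, dotProduct, h, Finset.sum_add_distrib]
  simp
  ring

lemma piece_mm {f : ℝ → ℝ} {s t : ℝ} (hs : 0 < s) (hst : s ≤ t)
    (hc : ContinuousOn f (Set.Icc s t))
    (hd : ∀ x ∈ Set.Ioo s t, HasDerivAt f (2 * f x / x) x) (ht : f t = t ^ 2) :
    f s = s ^ 2 := by
  have := aux_const (f := fun x => f x / x ^ 2) hst
    (hc.div (by fun_prop) (fun x hx => by have := hs.trans_le hx.1; positivity)) (by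
      intro x hx
      have hx0 : 0 < x := hs.trans hx.1
      refine HasDerivAt.congr_deriv ((hd x hx).div (hasDerivAt_pow 2 x) (by positivity)) (Eq.symm ?_)
      field_simp
      push_cast
      ring)
  have ht0 : 0 < t := by linarith
  simp only [ht] at this
  field_simp at this
  exact this

lemma piece_im {f : ℝ → ℝ} {s t μ B : ℝ} (hs : 0 < s) (hst : s ≤ t)
    (hc : ContinuousOn f (Set.Icc s t))
    (hd : ∀ x ∈ Set.Ioo s t, HasDerivAt f ((f x - μ * x ^ 2) / x) x) (ht : f t = t * B) :
    f s = s * (B + μ * (t - s)) := by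
  have := aux_const (f := fun x => f x / x + μ * x) hst
    ((hc.div (by fun_prop) (fun x hx => by have := hs.trans_le hx.1; positivity)).add (by fun_prop)) (by
      intro x hx
      have hx0 : 0 < x := hs.trans hx.1
      refine HasDerivAt.congr_deriv (((hd x hx).div (hasDerivAt_id x) (by simpa using hx0.ne')).add
        ((hasDerivAt_id x).const_mul μ)) (Eq.symm ?_)
      simp only [id]
      field_simp
      ring)
  have ht0 : 0 < t := by linarith
  simp only [ht] at this
  field_simp at this
  linarith

lemma piece_ij {f : ℝ → ℝ} {s t b c : ℝ} (hst : s ≤ t)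
    (hc : ContinuousOn f (Set.Icc s t))
    (hd : ∀ x ∈ Set.Ioo s t, HasDerivAt f (-(b + c * (t - x))) x) :
    f s = f t + b * (t - s) + c * (t - s) ^ 2 / 2 := by
  have := aux_const (f := fun x => f x + (b * x - c * (t - x) ^ 2 / 2)) hst
    (hc.add (by fun_prop)) (by
      intro x hx
      refine HasDerivAt.congr_deriv ((hd x hx).add (((hasDerivAt_id x).const_mul b).sub
        (((((hasDerivAt_id x).const_sub t).pow 2).const_mul c).div_const 2))) (Eq.symm ?_)
      simp only [id]
      push_cast
      ring)
  linarith

lemma tilted2_nonneg {M : ℕ} (m : Fin M) (π κ : Fin M × Fin M → ℝ)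
    (h1 : ∀ x, 0 ≤ π x) (h2 : ∀ x, 0 ≤ κ x) (w : ℝ) (x) : 0 ≤ tilted2 m π κ w x := by
  have hz : 0 ≤ Zw2 m π κ w := Finset.sum_nonneg fun x _ =>
    mul_nonneg (Real.rpow_nonneg (h1 x) _) (Real.rpow_nonneg (h2 x) _)
  unfold tilted2
  split_ifs
  · rfl
  · exact div_nonneg (mul_nonneg (Real.rpow_nonneg (h1 x) _) (Real.rpow_nonneg (h2 x) _)) hz

lemma cond21_mul {M : ℕ} (m : Fin M) (π κ : Fin M × Fin M → ℝ)
    (h1 : ∀ x, 0 ≤ π x) (h2 : ∀ x, 0 ≤ κ x) (w : ℝ) (i j : Fin M) (hj : j ≠ m) :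
    cond21 m π κ w i j * marg1 m π κ w i = tilted2 m π κ w (i, j) := by
  unfold cond21
  by_cases h : marg1 m π κ w i = 0
  · have := (Finset.sum_eq_zero_iff_of_nonneg
      (fun j _ => tilted2_nonneg m π κ h1 h2 w (i, j))).1 h j (by simp [hj])
    simp [h, this]
  · field_simp

lemma cond12_mul {M : ℕ} (m : Fin M) (π κ : Fin M × Fin M → ℝ)
    (h1 : ∀ x, 0 ≤ π x) (h2 : ∀ x, 0 ≤ κ x) (w : ℝ) (i j : Fin M) (hi : i ≠ m) :
    cond12 m π κ w i j * marg2 m π κ w j = tilted2 m π κ w (i, j) := by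
  unfold cond12
  by_cases h : marg2 m π κ w j = 0
  · have := (Finset.sum_eq_zero_iff_of_nonneg
      (fun i _ => tilted2_nonneg m π κ h1 h2 w (i, j))).1 h i (by simp [hi])
    simp [h, this]
  · field_simp

lemma piece_all {M : ℕ} (m : Fin M) (π κ : Fin M × Fin M → ℝ)
    (h1 : ∀ x, 0 ≤ π x) (h2 : ∀ x, 0 ≤ κ x) (σ : ℝ → ℝ) (w s t : ℝ)
    (hs : 0 ≤ s) (hst : s < t) (hcf : ∀ τ ∈ Set.Ioo s t, cFun σ τ = 1 / τ)
    (ρ : ℝ → Fin M × Fin M → ℝ) (hc : ContinuousOn ρ (Set.Icc s t))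
    (hd : ∀ τ ∈ Set.Ioo s t,
      HasDerivAt ρ (-((guidedRateNor2 m π κ σ w τ).mulVec (ρ τ))) τ)
    (i j : Fin M) (hi : i ≠ m) (hj : j ≠ m) (B C : ℝ)
    (hmm : ρ t (m, m) = t ^ 2) (hB : ρ t (i, m) = t * B) (hC : ρ t (m, j) = t * C) :
    (0 < s → ρ s (m, m) = s ^ 2 ∧ ρ s (i, m) = s * (B + marg1 m π κ w i * (t - s)) ∧
      ρ s (m, j) = s * (C + marg2 m π κ w j * (t - s))) ∧
    ρ s (i, j) = ρ t (i, j) + (t - s) * (cond21 m π κ w i j * B + cond12 m π κ w i j * C)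
      + (t - s) ^ 2 * tilted2 m π κ w (i, j) := by
  have hc' : ∀ x, ContinuousOn (fun τ => ρ τ x) (Set.Icc s t) := continuousOn_pi.1 hc
  have hcu : ∀ u, s ≤ u → ∀ x, ContinuousOn (fun τ => ρ τ x) (Set.Icc u t) :=
    fun u hu x => (hc' x).mono (Set.Icc_subset_Icc_left hu)
  have hd' := fun τ hτ => hasDerivAt_pi.1 (hd τ hτ)
  have hA : ∀ u, 0 < u → s ≤ u → u ≤ t → ρ u (m, m) = u ^ 2 := by
    intro u hu hsu hut
    refine piece_mm hu hut (hcu u hsu (m, m)) ?_ hmm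
    intro x hx
    have hx' : x ∈ Set.Ioo s t := ⟨hsu.trans_lt hx.1, hx.2⟩
    refine HasDerivAt.congr_deriv (hd' x hx' (m, m)) (Eq.symm ?_)
    rw [Pi.neg_apply, row_mm, hcf x hx']
    ring
  have hBu : ∀ u, 0 < u → s ≤ u → u ≤ t →
      ρ u (i, m) = u * (B + marg1 m π κ w i * (t - u)) := by
    intro u hu hsu hut
    refine piece_im hu hut (hcu u hsu (i, m)) ?_ hB
    intro x hx
    have hx' : x ∈ Set.Ioo s t := ⟨hsu.trans_lt hx.1, hx.2⟩
    refine HasDerivAt.congr_deriv (hd' x hx' (i, m)) (Eq.symm ?_)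
    rw [Pi.neg_apply, row_im _ _ _ _ _ _ _ _ hi, hcf x hx', hA x (hu.trans hx.1) hx'.1.le hx'.2.le]
    ring
  have hCu : ∀ u, 0 < u → s ≤ u → u ≤ t →
      ρ u (m, j) = u * (C + marg2 m π κ w j * (t - u)) := by
    intro u hu hsu hut
    refine piece_im hu hut (hcu u hsu (m, j)) ?_ hC
    intro x hx
    have hx' : x ∈ Set.Ioo s t := ⟨hsu.trans_lt hx.1, hx.2⟩
    refine HasDerivAt.congr_deriv (hd' x hx' (m, j)) (Eq.symm ?_)
    rw [Pi.neg_apply, row_mj _ _ _ _ _ _ _ _ hj, hcf x hx', hA x (hu.trans hx.1) hx'.1.le hx'.2.le]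
    ring
  refine ⟨fun h => ⟨hA s h le_rfl hst.le, hBu s h le_rfl hst.le, hCu s h le_rfl hst.le⟩, ?_⟩
  have := piece_ij (b := cond21 m π κ w i j * B + cond12 m π κ w i j * C)
    (c := 2 * tilted2 m π κ w (i, j)) hst.le (hc' (i, j)) (by
    intro x hx
    have hx0 : 0 < x := hs.trans_lt hx.1
    refine HasDerivAt.congr_deriv (hd' x hx (i, j)) (Eq.symm ?_)
    rw [Pi.neg_apply, row_ij _ _ _ _ _ _ _ _ _ hi hj, hcf x hx, hBu x hx0 hx.1.le hx.2.le,
      hCu x hx0 hx.1.le hx.2.le]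
    have e1 := cond21_mul m π κ h1 h2 w i j hj
    have e2 := cond12_mul m π κ h1 h2 w i j hi
    field_simp
    linear_combination (t - x) * e1 + (t - x) * e2)
  linarith

/-- Suppose `σ̄ t = -log (1 - δ t)` for some `δ ∈ (0,1)`, and let
`0 = t_0 < t_1 < t_2 < t_3 = 1` be a time partition with guidance strengths `w_0, w_1, w_2`
on the respective intervals.  Let `ρ` be continuous on `[0, 1]` with `ρ 1` the indicator of
the fully masked state `(m, m)`, and a reverse-dynamics solution for the column-normalized
2D family `(R̄_nor^{(w_i)}_τ)` on each `(t_i, t_{i+1})`.  Then for all `i, j ≠ m`: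
`ρ 0 (i,j) = (1-t₂)² p^{(w₂)}(i,j) + (t₂-t₁)² p^{(w₁)}(i,j) + t₁² p^{(w₀)}(i,j)
  + (1-t₂)(t₂-t₁) p^{(w₁,w₂)}(i,j) + (1-t₂)t₁ p^{(w₀,w₂)}(i,j) + (t₂-t₁)t₁ p^{(w₀,w₁)}(i,j)`. -/
theorem normalized_guided_reverse_dynamics_2d_three_pieces
    (M : ℕ) (hM : 2 ≤ M) (m : Fin M) (hm : (m : ℕ) = M - 1)
    (π κ : Fin M × Fin M → ℝ)
    (hπ_nonneg : ∀ x, 0 ≤ π x) (hπ_sum : ∑ x, π x = 1)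
    (hπ_zero : ∀ x : Fin M × Fin M, x.1 = m ∨ x.2 = m → π x = 0)
    (hπ_pos : ∀ x : Fin M × Fin M, x.1 ≠ m → x.2 ≠ m → 0 < π x)
    (hκ_nonneg : ∀ x, 0 ≤ κ x) (hκ_sum : ∑ x, κ x = 1)
    (hκ_zero : ∀ x : Fin M × Fin M, x.1 = m ∨ x.2 = m → κ x = 0)
    (hκ_pos : ∀ x : Fin M × Fin M, x.1 ≠ m → x.2 ≠ m → 0 < κ x)
    (δ : ℝ) (hδ : 0 < δ) (hδ1 : δ < 1)
    (σ : ℝ → ℝ) (hσ : ∀ u, σ u = δ / (1 - δ * u))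
    (hσbar : ∀ u, 0 ≤ u → u < 1 / δ → sigmaBar σ u = -Real.log (1 - δ * u))
    (t₁ t₂ : ℝ) (ht₁ : 0 < t₁) (ht₁₂ : t₁ < t₂) (ht₂ : t₂ < 1)
    (w₀ w₁ w₂ : ℝ)
    (ρ : ℝ → Fin M × Fin M → ℝ)
    (hρcont : ContinuousOn ρ (Set.Icc (0 : ℝ) 1))
    (hρ1 : ρ 1 = fun x => if x = (m, m) then 1 else 0)
    (hρsol0 : ∀ τ ∈ Set.Ioo (0 : ℝ) t₁,
      HasDerivAt ρ (-((guidedRateNor2 m π κ σ w₀ τ).mulVec (ρ τ))) τ)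
    (hρsol1 : ∀ τ ∈ Set.Ioo t₁ t₂,
      HasDerivAt ρ (-((guidedRateNor2 m π κ σ w₁ τ).mulVec (ρ τ))) τ)
    (hρsol2 : ∀ τ ∈ Set.Ioo t₂ (1 : ℝ),
      HasDerivAt ρ (-((guidedRateNor2 m π κ σ w₂ τ).mulVec (ρ τ))) τ) :
    ∀ i j : Fin M, i ≠ m → j ≠ m →
      ρ 0 (i, j) =
        (1 - t₂) ^ 2 * tilted2 m π κ w₂ (i, j) +
        (t₂ - t₁) ^ 2 * tilted2 m π κ w₁ (i, j) +
        t₁ ^ 2 * tilted2 m π κ w₀ (i, j) +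
        (1 - t₂) * (t₂ - t₁) * combined m π κ w₁ w₂ i j +
        (1 - t₂) * t₁ * combined m π κ w₀ w₂ i j +
        (t₂ - t₁) * t₁ * combined m π κ w₀ w₁ i j := by
  intro i j hi hj
  have hcf : ∀ τ ∈ Set.Ioo (0 : ℝ) 1, cFun σ τ = 1 / τ := by
    rintro τ ⟨h0, h1⟩
    have hp : 0 < 1 - δ * τ := by nlinarith
    have hlt : τ < 1 / δ := by rw [lt_div_iff₀ hδ]; nlinarith
    rw [cFun, hσbar τ h0.le hlt, neg_neg, Real.exp_log hp, hσ]
    have : (1 - (1 - δ * τ)) = δ * τ := by ring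
    rw [this]
    field_simp
  have p2 := piece_all m π κ hπ_nonneg hκ_nonneg σ w₂ t₂ 1 (by linarith) ht₂
    (fun τ h => hcf τ ⟨by linarith [h.1], h.2⟩) ρ
    (hρcont.mono (Set.Icc_subset_Icc (by linarith) le_rfl)) hρsol2 i j hi hj 0 0
    (by simp [hρ1]) (by simp [hρ1, hi]) (by simp [hρ1, hj])
  obtain ⟨a2, b2, c2⟩ := p2.1 (by linarith)
  have p1 := piece_all m π κ hπ_nonneg hκ_nonneg σ w₁ t₁ t₂ (by linarith) ht₁₂
    (fun τ h => hcf τ ⟨by linarith [h.1], by linarith [h.2]⟩) ρ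
    (hρcont.mono (Set.Icc_subset_Icc (by linarith) ht₂.le)) hρsol1 i j hi hj _ _ a2 b2 c2
  obtain ⟨a1, b1, c1⟩ := p1.1 ht₁
  have p0 := piece_all m π κ hπ_nonneg hκ_nonneg σ w₀ 0 t₁ le_rfl ht₁
    (fun τ h => hcf τ ⟨h.1, by linarith [h.2]⟩) ρ
    (hρcont.mono (Set.Icc_subset_Icc le_rfl (by linarith))) hρsol0 i j hi hj _ _ a1 b1 c1
  have h1 : ρ 1 (i, j) = 0 := by simp [hρ1, hi]
  rw [p0.2, p1.2, p2.2, h1]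
  unfold combined
  ring
end

section
/- Let S be a finite type, let R be a real matrix indexed by S with every column summing to zero (∑_y R y x = 0 for all x), and let p : S → ℝ be pointwise positive. Define the reverse rate matrix R̄ by R̄ y x = R x y · (p y / p x) for y ≠ x, and R̄ x x = −∑_{y ≠ x} R̄ y x. Then R̄.mulVec p = −(R.mulVec p). Consequently, if p_t is a pointwise-positive solution of the forward equation d p_t/dt = R_t.mulVec p_t on (0,T), then t ↦ p_{T−t} satisfies d/dt p_{T−t} = R̄_{T−t}.mulVec p_{T−t}, i.e. the reverse rate matrix generates the time reversal of the continuous-time Markov chain. -/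
open Finset

/-- The reverse rate matrix `R̄` associated with a rate matrix `R` and a positive vector `p`:
`R̄ y x = R x y · (p y / p x)` for `y ≠ x`, and `R̄ x x = -∑_{y ≠ x} R̄ y x`. -/
noncomputable def reverseRate {S : Type*} [Fintype S] [DecidableEq S]
    (R : Matrix S S ℝ) (p : S → ℝ) : Matrix S S ℝ :=
  fun y x =>
    if y = x then -∑ z ∈ Finset.univ.filter (fun z => z ≠ x), R x z * (p z / p x)
    else R x y * (p y / p x)

theorem reverseRate_aux {S : Type*} [Fintype S] [DecidableEq S]
    (R : Matrix S S ℝ) (hR : ∀ x, ∑ y, R y x = 0) (p : S → ℝ) (hp : ∀ x, 0 < p x) :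
    (reverseRate R p).mulVec p = -(R.mulVec p) := by
  funext y
  have hy := hR y
  have hf : Finset.univ.filter (fun z => z ≠ y) = Finset.univ.erase y := by
    ext z; simp
  simp only [Matrix.mulVec, dotProduct, Pi.neg_apply]
  rw [← Finset.add_sum_erase _ _ (Finset.mem_univ y)] at hy ⊢
  rw [← Finset.add_sum_erase _ (fun i => R y i * p i) (Finset.mem_univ y)]
  have h1 : reverseRate R p y y * p y = -∑ z ∈ Finset.univ.erase y, R y z * p z := by
    have hpy := (hp y).ne'
    simp only [reverseRate, if_true, hf]
    rw [neg_mul, Finset.sum_mul]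
    congr 1
    refine Finset.sum_congr rfl fun z _ => ?_
    field_simp
  have h2 : ∑ x ∈ Finset.univ.erase y, reverseRate R p y x * p x
      = (∑ x ∈ Finset.univ.erase y, R x y) * p y := by
    rw [Finset.sum_mul]
    refine Finset.sum_congr rfl fun x hx => ?_
    have hpx := (hp x).ne'
    have hne : y ≠ x := (Finset.ne_of_mem_erase hx).symm
    simp only [reverseRate, if_neg hne]
    field_simp
  rw [h1, h2]
  linear_combination p y * hy

/-- Let `S` be a finite type, let `R` be a real matrix indexed by `S` with
every column summing to zero, and let `p : S → ℝ` be pointwise positive.  With the reverse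
rate matrix `R̄` defined above, `R̄.mulVec p = -(R.mulVec p)`.  Consequently, if `p_t` is a
pointwise-positive solution of the forward equation `d p_t/dt = R_t.mulVec p_t` on `(0, T)`,
then `t ↦ p_{T-t}` satisfies `d/dt p_{T-t} = R̄_{T-t}.mulVec p_{T-t}`: the reverse rate
matrix generates the time reversal of the continuous-time Markov chain. -/
theorem reverseRate_mulVec_and_time_reversal (S : Type*) [Fintype S] [DecidableEq S] :
    (∀ (R : Matrix S S ℝ), (∀ x, ∑ y, R y x = 0) → ∀ p : S → ℝ, (∀ x, 0 < p x) →
      (reverseRate R p).mulVec p = -(R.mulVec p)) ∧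
    (∀ (T : ℝ), 0 < T →
      ∀ (Rfam : ℝ → Matrix S S ℝ), (∀ t x, ∑ y, Rfam t y x = 0) →
      ∀ pfam : ℝ → S → ℝ,
        (∀ t ∈ Set.Ioo (0 : ℝ) T, ∀ x, 0 < pfam t x) →
        (∀ t ∈ Set.Ioo (0 : ℝ) T, HasDerivAt pfam ((Rfam t).mulVec (pfam t)) t) →
        ∀ t ∈ Set.Ioo (0 : ℝ) T,
          HasDerivAt (fun u => pfam (T - u))
            ((reverseRate (Rfam (T - t)) (pfam (T - t))).mulVec (pfam (T - t))) t) := by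
  refine ⟨fun R hR p hp => reverseRate_aux R hR p hp, ?_⟩
  intro T _ Rfam hR pfam hpos hd t ht
  have ht' : T - t ∈ Set.Ioo (0 : ℝ) T := ⟨by linarith [ht.2], by linarith [ht.1]⟩
  rw [reverseRate_aux _ (hR _) _ (hpos _ ht')]
  exact (hd _ ht').comp_const_sub T t
end

section
/- Let w : ℝ → ℝ be continuous on (0,T], let t ∈ (0,T), and let ρ be a reverse-dynamics solution for the family (R^{(w_s)}_s) on [t, T] with terminal condition ρ T equal to the indicator vector of the mask state m. Then the conditional law of ρ t on unmasked states is the weighted average of tilted distributions given by the guidance schedule: for every i ≠ m, ρ t i / (1 − ρ t m) = (∫_t^T c s · Z_{w s} · p^{(w s)} i · exp(−∫_s^T c τ Z_{w τ} dτ) ds) / (1 − exp(−∫_t^T c s Z_{w s} ds)). -/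
open Finset

theorem aux_ode (t T : ℝ) (h : t < T) (a b x y : ℝ → ℝ)
    (ha : ContinuousOn a (Set.Icc t T)) (hb : ContinuousOn b (Set.Icc t T))
    (hx : ContinuousOn x (Set.Icc t T)) (hy : ContinuousOn y (Set.Icc t T))
    (hx' : ∀ s ∈ Set.Ioo t T, HasDerivAt x (a s * x s) s)
    (hy' : ∀ s ∈ Set.Ioo t T, HasDerivAt y (-(b s * x s)) s)
    (hxT : x T = 1) (hyT : y T = 0) :
    x t = Real.exp (-(∫ s in t..T, a s)) ∧
      y t = ∫ s in t..T, b s * Real.exp (-(∫ τ in s..T, a τ)) := by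
  have hai : ∀ s ∈ Set.Icc t T, IntervalIntegrable a MeasureTheory.volume s T := by
    intro s hs
    apply ContinuousOn.intervalIntegrable
    rw [Set.uIcc_of_le hs.2]
    exact ha.mono (Set.Icc_subset_Icc hs.1 le_rfl)
  have hLd : ∀ s ∈ Set.Ioo t T, HasDerivAt (fun s => ∫ τ in s..T, a τ) (-a s) s := by
    intro s hs
    apply intervalIntegral.integral_hasDerivAt_left (hai s ⟨hs.1.le, hs.2.le⟩)
    · exact ContinuousOn.stronglyMeasurableAtFilter isOpen_Ioo
        (ha.mono Set.Ioo_subset_Icc_self) s hs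
    · exact ha.continuousAt (Icc_mem_nhds hs.1 hs.2)
  have hLc : ContinuousOn (fun s => ∫ τ in s..T, a τ) (Set.Icc t T) := by
    have h0 := intervalIntegral.continuousOn_primitive_interval_left (a := t) (b := T) (f := a)
      (μ := MeasureTheory.volume) (by
        rw [Set.uIcc_of_le h.le]; exact ha.integrableOn_Icc)
    rwa [Set.uIcc_of_le h.le] at h0
  have key : ∀ s ∈ Set.Icc t T, x s = Real.exp (-(∫ τ in s..T, a τ)) := by
    intro s hs
    have h1 := intervalIntegral.integral_eq_sub_of_hasDerivAt_of_le hs.2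
      (f := fun s => x s * Real.exp (∫ τ in s..T, a τ)) (f' := fun _ => 0)
      ((hx.mul hLc.rexp).mono (Set.Icc_subset_Icc hs.1 le_rfl))
      (by
        intro u hu
        have hu' : u ∈ Set.Ioo t T := ⟨hs.1.trans_lt hu.1, hu.2⟩
        refine ((hx' u hu').mul (hLd u hu').exp).congr_deriv ?_
        ring) (by simp)
    simp [hxT] at h1
    rw [Real.exp_neg]
    apply eq_inv_of_mul_eq_one_left
    linarith
  refine ⟨key t ⟨le_rfl, h.le⟩, ?_⟩
  have h2 := intervalIntegral.integral_eq_sub_of_hasDerivAt_of_le h.le hy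
    (f' := fun s => -(b s * x s)) hy'
    (by
      apply ContinuousOn.intervalIntegrable
      rw [Set.uIcc_of_le h.le]
      exact (hb.mul hx).neg)
  rw [intervalIntegral.integral_neg, hyT] at h2
  have h3 : y t = ∫ s in t..T, b s * x s := by linarith
  rw [h3]
  apply intervalIntegral.integral_congr
  intro s hs
  rw [Set.uIcc_of_le h.le] at hs
  simp only [key s hs]

/-- Let `w : ℝ → ℝ` be continuous on `(0, T]`, let `t ∈ (0, T)`, and let
`ρ` be a reverse-dynamics solution for the family `(R^{(w_s)}_s)` on `[t, T]` with terminal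
condition `ρ T` = the indicator of the mask state `m`.  Then the conditional law of `ρ t` on
unmasked states is the weighted average of tilted distributions given by the guidance
schedule: for every `i ≠ m`,
`ρ t i / (1 - ρ t m)
  = (∫_t^T c s · Z_{w s} · p^{(w s)} i · exp(-∫_s^T c τ Z_{w τ} dτ) ds)
      / (1 - exp(-∫_t^T c s Z_{w s} ds))`. -/
theorem guided_reverse_dynamics_conditional_law
    (M : ℕ) (hM : 2 ≤ M) (m : Fin M) (hm : (m : ℕ) = M - 1)
    (p q : Fin M → ℝ)
    (hp_nonneg : ∀ i, 0 ≤ p i) (hp_sum : ∑ i, p i = 1) (hpm : p m = 0)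
    (hp_pos : ∀ i, i ≠ m → 0 < p i)
    (hq_nonneg : ∀ i, 0 ≤ q i) (hq_sum : ∑ i, q i = 1) (hqm : q m = 0)
    (hq_pos : ∀ i, i ≠ m → 0 < q i)
    (T : ℝ) (hT : 0 < T)
    (σ : ℝ → ℝ) (hσ : Continuous σ) (hσpos : ∀ t, 0 < t → 0 < σ t)
    (w : ℝ → ℝ) (hw : ContinuousOn w (Set.Ioc 0 T))
    (t : ℝ) (ht : t ∈ Set.Ioo 0 T)
    (ρ : ℝ → Fin M → ℝ)
    (hρ : IsReverseSol (fun s => guidedRate m p q σ (w s) s) (Set.Icc t T) ρ)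
    (hρT : ρ T = fun i => if i = m then 1 else 0) :
    ∀ i, i ≠ m →
      ρ t i / (1 - ρ t m) =
        (∫ s in t..T,
            cFun σ s * Zw m p q (w s) * tilted m p q (w s) i *
              Real.exp (-(∫ τ in s..T, cFun σ τ * Zw m p q (w τ)))) /
          (1 - Real.exp (-(∫ s in t..T, cFun σ s * Zw m p q (w s)))) := by
  intro i hi
  obtain ⟨hρc, hρd⟩ := hρ
  rw [interior_Icc] at hρd
  have hsub : Set.Icc t T ⊆ Set.Ioc 0 T := fun s hs => ⟨ht.1.trans_le hs.1, hs.2⟩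
  have hw' := hw.mono hsub
  have hterm : ∀ j, j ≠ m →
      ContinuousOn (fun s => (p j) ^ (w s) * (q j) ^ (1 - w s)) (Set.Icc t T) := by
    intro j hj
    exact (continuousOn_const.rpow hw' (fun _ _ => Or.inl (hp_pos j hj).ne')).mul
      (continuousOn_const.rpow (continuousOn_const.sub hw')
        (fun _ _ => Or.inl (hq_pos j hj).ne'))
  have hZ : ContinuousOn (fun s => Zw m p q (w s)) (Set.Icc t T) := by
    unfold Zw
    apply continuousOn_finsetSum
    intro j hj
    exact hterm j (by simpa using hj)
  have hZpos : ∀ v, 0 < Zw m p q v := by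
    intro v
    unfold Zw
    apply Finset.sum_pos
    · intro j hj
      have hj' : j ≠ m := by simpa using hj
      exact mul_pos (Real.rpow_pos_of_pos (hp_pos j hj') _) (Real.rpow_pos_of_pos (hq_pos j hj') _)
    · exact ⟨i, by simpa using hi⟩
  have htilt : ContinuousOn (fun s => tilted m p q (w s) i) (Set.Icc t T) := by
    simp only [tilted, if_neg hi]
    exact (hterm i hi).div hZ (fun s _ => (hZpos _).ne')
  have hsb : Continuous (sigmaBar σ) :=
    intervalIntegral.continuous_primitive (fun a b => hσ.intervalIntegrable a b) 0
  have hc : ContinuousOn (cFun σ) (Set.Icc t T) := by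
    unfold cFun
    refine ContinuousOn.div (by fun_prop) (by fun_prop) ?_
    intro s hs
    have h0 : 0 < s := (hsub hs).1
    have : 0 < sigmaBar σ s :=
      intervalIntegral.intervalIntegral_pos_of_pos_on (hσ.intervalIntegrable _ _)
        (fun u hu => hσpos u hu.1) h0
    have : Real.exp (-(sigmaBar σ s)) < 1 := by
      rw [Real.exp_lt_one_iff]; linarith
    linarith
  have hmv : ∀ s j, ((guidedRate m p q σ (w s) s).mulVec (ρ s)) j =
      cFun σ s * Zw m p q (w s) * (if j = m then -1 else tilted m p q (w s) j) * ρ s m := by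
    intro s j
    simp [guidedRate, Amat, Matrix.mulVec, dotProduct]
  have hres := aux_ode t T ht.2 (fun s => cFun σ s * Zw m p q (w s))
    (fun s => cFun σ s * Zw m p q (w s) * tilted m p q (w s) i)
    (fun s => ρ s m) (fun s => ρ s i) (hc.mul hZ) ((hc.mul hZ).mul htilt)
    ((continuous_apply m).comp_continuousOn hρc) ((continuous_apply i).comp_continuousOn hρc)
    (by
      intro s hs
      have := (hasDerivAt_pi.1 (hρd s hs)) m
      refine this.congr_deriv ?_
      rw [Pi.neg_apply, hmv]
      simp)
    (by
      intro s hs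
      have := (hasDerivAt_pi.1 (hρd s hs)) i
      refine this.congr_deriv ?_
      rw [Pi.neg_apply, hmv]
      simp [hi])
    (by simp [hρT]) (by simp [hρT, hi])
  rw [hres.1, hres.2]
end

section
/- Fix a constant guidance strength w ∈ ℝ and 0 < s < t ≤ T, and let ρ be a reverse-dynamics solution for the constant-guidance family (R^{(w)}_τ) on [s, t] with ρ t m > 0. Then the mask probability satisfies ρ s m = ρ t m · exp(−Z_w · ∫_s^t c τ dτ) = ρ t m · ((1 − exp(−σ̄ s))/(1 − exp(−σ̄ t)))^{Z_w}; that is, applying guidance strength w rescales the cumulative unmasking rate by the factor Z_w in the exponent, so that larger Z_w yields strictly faster unmasking. -/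
open Finset

/-- Fix a constant guidance strength `w ∈ ℝ` and `0 < s < t ≤ T`, and let
`ρ` be a reverse-dynamics solution for the constant-guidance family `(R^{(w)}_τ)` on `[s, t]`
with `ρ t m > 0`.  Then the mask probability satisfies
`ρ s m = ρ t m · exp(-Z_w · ∫_s^t c τ dτ)
       = ρ t m · ((1 - exp(-σ̄ s))/(1 - exp(-σ̄ t)))^{Z_w}`:
guidance strength `w` rescales the cumulative unmasking rate by the factor `Z_w` in the
exponent. -/
theorem guided_mask_probability_exponential_rescaling
    (M : ℕ) (hM : 2 ≤ M) (m : Fin M) (hm : (m : ℕ) = M - 1)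
    (p q : Fin M → ℝ)
    (hp_nonneg : ∀ i, 0 ≤ p i) (hp_sum : ∑ i, p i = 1) (hpm : p m = 0)
    (hp_pos : ∀ i, i ≠ m → 0 < p i)
    (hq_nonneg : ∀ i, 0 ≤ q i) (hq_sum : ∑ i, q i = 1) (hqm : q m = 0)
    (hq_pos : ∀ i, i ≠ m → 0 < q i)
    (T : ℝ) (hT : 0 < T)
    (σ : ℝ → ℝ) (hσ : Continuous σ) (hσpos : ∀ t, 0 < t → 0 < σ t)
    (w : ℝ) (s t : ℝ) (hs : 0 < s) (hst : s < t) (htT : t ≤ T)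
    (ρ : ℝ → Fin M → ℝ)
    (hρ : IsReverseSol (fun τ => guidedRate m p q σ w τ) (Set.Icc s t) ρ)
    (hρtm : 0 < ρ t m) :
    ρ s m = ρ t m * Real.exp (-(Zw m p q w * ∫ τ in s..t, cFun σ τ)) ∧
    ρ s m = ρ t m *
        ((1 - Real.exp (-(sigmaBar σ s))) / (1 - Real.exp (-(sigmaBar σ t)))) ^
          Zw m p q w := by
  have hsb : ∀ τ, HasDerivAt (sigmaBar σ) (σ τ) τ := fun τ =>
    intervalIntegral.integral_hasDerivAt_right (hσ.intervalIntegrable _ _)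
      hσ.stronglyMeasurable.stronglyMeasurableAtFilter hσ.continuousAt
  have hsbpos : ∀ τ, 0 < τ → 0 < sigmaBar σ τ := fun τ hτ =>
    intervalIntegral.intervalIntegral_pos_of_pos_on (hσ.intervalIntegrable _ _)
      (fun x hx => hσpos x hx.1) hτ
  have hF : ∀ τ, 0 < τ → 0 < 1 - Real.exp (-(sigmaBar σ τ)) := fun τ hτ => by
    have : Real.exp (-(sigmaBar σ τ)) < 1 := by simpa using hsbpos τ hτ
    linarith
  have hL : ∀ τ, 0 < τ →
      HasDerivAt (fun τ => Real.log (1 - Real.exp (-(sigmaBar σ τ)))) (cFun σ τ) τ := by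
    intro τ hτ
    have h := (((hsb τ).neg.exp).const_sub 1).log (hF τ hτ).ne'
    refine h.congr_deriv ?_
    simp only [cFun, Pi.neg_apply]
    ring
  have hsbc : Continuous (sigmaBar σ) :=
    continuous_iff_continuousAt.mpr fun τ => (hsb τ).continuousAt
  have hcc : ContinuousOn (cFun σ) (Set.uIcc s t) := by
    rw [Set.uIcc_of_le hst.le]
    unfold cFun
    refine ContinuousOn.div (by fun_prop) (by fun_prop) ?_
    intro x hx
    exact (hF x (hs.trans_le hx.1)).ne'
  have hint : ∫ τ in s..t, cFun σ τ = Real.log (1 - Real.exp (-(sigmaBar σ t)))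
      - Real.log (1 - Real.exp (-(sigmaBar σ s))) := by
    refine intervalIntegral.integral_eq_sub_of_hasDerivAt
      (f := fun τ => Real.log (1 - Real.exp (-(sigmaBar σ τ)))) ?_ hcc.intervalIntegrable
    intro x hx
    rw [Set.uIcc_of_le hst.le] at hx
    exact hL x (hs.trans_le hx.1)
  obtain ⟨hρc, hρd⟩ := hρ
  rw [interior_Icc] at hρd
  set Z := Zw m p q w with hZ
  have hmd : ∀ τ ∈ Set.Ioo s t, HasDerivAt (fun τ => ρ τ m) (cFun σ τ * Z * ρ τ m) τ := by
    intro τ hτ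
    have h := (hasDerivAt_pi.mp (hρd τ hτ)) m
    refine h.congr_deriv ?_
    simp [guidedRate, Amat, Matrix.mulVec, dotProduct, hZ]
  have hg : ρ t m * Real.exp (-(Z * Real.log (1 - Real.exp (-(sigmaBar σ t)))))
      = ρ s m * Real.exp (-(Z * Real.log (1 - Real.exp (-(sigmaBar σ s))))) := by
    have hcont : ContinuousOn (fun τ => ρ τ m *
        Real.exp (-(Z * Real.log (1 - Real.exp (-(sigmaBar σ τ)))))) (Set.Icc s t) := by
      refine ContinuousOn.mul (continuousOn_pi.mp hρc m) ?_
      refine ContinuousOn.rexp (ContinuousOn.neg (ContinuousOn.mul continuousOn_const ?_))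
      intro x hx
      exact (hL x (hs.trans_le hx.1)).continuousAt.continuousWithinAt
    have hder : ∀ τ ∈ Set.Ioo s t, HasDerivAt (fun τ => ρ τ m *
        Real.exp (-(Z * Real.log (1 - Real.exp (-(sigmaBar σ τ)))))) 0 τ := by
      intro τ hτ
      refine ((hmd τ hτ).mul (((hL τ (hs.trans hτ.1)).const_mul Z).neg.exp)).congr_deriv ?_
      simp only [Pi.neg_apply]
      ring
    obtain ⟨x, hx, h⟩ := exists_hasDerivAt_eq_slope _ _ hst hcont hder
    have hne : t - s ≠ 0 := (sub_pos.mpr hst).ne'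
    rw [eq_comm, div_eq_zero_iff] at h
    exact sub_eq_zero.mp (h.resolve_right hne)
  have key : ρ s m = ρ t m * Real.exp (-(Z * ∫ τ in s..t, cFun σ τ)) := by
    rw [hint, mul_sub, neg_sub, sub_eq_add_neg, add_comm, Real.exp_add, ← mul_assoc, hg,
      mul_assoc, ← Real.exp_add]
    simp
  refine ⟨key, ?_⟩
  rw [key, Real.rpow_def_of_pos (div_pos (hF s hs) (hF t (hs.trans hst))),
    Real.log_div (hF s hs).ne' (hF t (hs.trans hst)).ne', hint]
  congr 2
  ring
end
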